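/- Let d≥2 and k∈{1,…,d−1}. Let X_1,…,X_n be i.i.d. uniform random points in B_2^k×B_2^{d−k}⊂ℝ^d and P_n=conv{X_1,…,X_n}. If 2k=d then E f_{d−1}(P_n) ≍ n^{(k−1)/(k+1)} ln n, and if 2k≠d then E f_{d−1}(P_n) ≍ n^{(M−1)/(M+1)} with M=max{k,d−k}; in both cases the implied constants depend only on d and k. -/

import Mathlib

open MeasureTheory Filter

noncomputable section

/-- The number of `j`-dimensional faces of a convex body `K`: faces are the nonempty
convex extreme subsets of `K`, and the dimension of a face is the dimension of its
affine hull. -/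
def faceCount {E : Type*} [AddCommGroup E] [Module ℝ E] (K : Set E) (j : ℕ) : ℕ :=
  Nat.card {F : Set E // F.Nonempty ∧ Convex ℝ F ∧ IsExtreme ℝ K F ∧
    Module.finrank ℝ (vectorSpan ℝ F) = j}

/-- The uniform distribution (normalized Lebesgue measure) on a set `K`. -/
def uniformDist {α : Type*} [MeasureSpace α] (K : Set α) : Measure α :=
  (volume K)⁻¹ • volume.restrict K

/-- Expected number of facets of the convex hull of `n` i.i.d. uniform random points
in the product of balls `B_2^k × B_2^{d−k} ⊂ ℝ^d`. -/
def expectedFacetsProd (d k n : ℕ) : ℝ :=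
  ∫ x : Fin n → EuclideanSpace ℝ (Fin k) × EuclideanSpace ℝ (Fin (d - k)),
    (faceCount (convexHull ℝ (Set.range x)) (d - 1) : ℝ)
    ∂(Measure.pi fun _ : Fin n => uniformDist
        (Metric.closedBall (0 : EuclideanSpace ℝ (Fin k)) 1 ×ˢ
          Metric.closedBall (0 : EuclideanSpace ℝ (Fin (d - k))) 1))

/-- The cap of height `σ` of the unit ball in direction `u`. -/
def ballCap {E : Type*} [NormedAddCommGroup E] [InnerProductSpace ℝ E] (u : E) (σ : ℝ) : Set E :=
  {x | ‖x‖ ≤ 1 ∧ 1 - inner ℝ u x ≤ σ}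

/-- The part of the cap of height `σ / 4` which keeps distance at least `σ / 10` from the sphere. -/
def deepCap {E : Type*} [NormedAddCommGroup E] [InnerProductSpace ℝ E] (u : E) (σ : ℝ) : Set E :=
  {x | σ / 10 ≤ 1 - ‖x‖ ∧ 1 - inner ℝ u x ≤ σ / 4}

/-- The points of the unit ball that share a cap of height comparable to `1 - ‖x‖` with `x`. -/
def capNhd {E : Type*} [NormedAddCommGroup E] [InnerProductSpace ℝ E] (x : E) : Set E :=
  {y | ‖y‖ ≤ 1 ∧ 1 - inner ℝ x y ≤ 45 * (1 - ‖x‖)}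

/-- Scaling by `σ` along the unit vector `u` and by `√σ` orthogonally to it. -/
def capScale {E : Type*} [NormedAddCommGroup E] [InnerProductSpace ℝ E] (u : E) (σ : ℝ) :
    E →ₗ[ℝ] E :=
  √σ • LinearMap.transvection (innerₛₗ ℝ u) ((√σ - 1) • u)

section Caps

open scoped Pointwise

variable {E : Type*} [NormedAddCommGroup E] [InnerProductSpace ℝ E]

lemma one_sub_inner_le {u x y : E} (hu : ‖u‖ = 1) (hx : ‖x‖ ≤ 1) (hy : ‖y‖ ≤ 1) :
    1 - inner ℝ x y ≤ 2 * ((1 - inner ℝ u x) + (1 - inner ℝ u y)) := by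
  have h1 := norm_sub_sq_real x y
  have h2 := norm_sub_sq_real x u
  have h3 := norm_sub_sq_real y u
  have h4 : ‖x - y‖ ≤ ‖x - u‖ + ‖y - u‖ := by
    have := norm_sub_le (x - u) (y - u)
    simpa using this
  rw [real_inner_comm] at h2 h3
  rw [hu] at h2 h3
  have h5 : ‖x - y‖ ^ 2 ≤ 2 * ‖x - u‖ ^ 2 + 2 * ‖y - u‖ ^ 2 := by
    nlinarith [norm_nonneg (x - y), sq_nonneg (‖x - u‖ - ‖y - u‖)]
  nlinarith [norm_nonneg x, norm_nonneg y]

lemma capScale_apply (u : E) (σ : ℝ) (v : E) :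
    capScale u σ v = √σ • (v + (inner ℝ u v * (√σ - 1)) • u) := by
  simp [capScale, LinearMap.transvection.apply, smul_smul]

lemma det_capScale [FiniteDimensional ℝ E] {u : E} (hu : ‖u‖ = 1) (σ : ℝ) :
    LinearMap.det (capScale u σ) = √σ ^ (Module.finrank ℝ E + 1) := by
  rw [capScale, LinearMap.det_smul, LinearMap.transvection.det]
  simp [hu]
  ring

lemma ballCap_subset {u : E} (hu : ‖u‖ = 1) {σ : ℝ} (hσ : 0 < σ) :
    ballCap u σ ⊆ u +ᵥ (capScale u σ '' Metric.closedBall 0 2) := by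
  rintro x ⟨hx, hxu⟩
  have hs : 0 < √σ := Real.sqrt_pos.2 hσ
  have hss : √σ * √σ = σ := Real.mul_self_sqrt hσ.le
  have huu : inner ℝ u u = (1 : ℝ) := by rw [real_inner_self_eq_norm_sq, hu]; norm_num
  set α : ℝ := inner ℝ u x - 1 with hα
  have hα0 : α ≤ 0 := by
    have := real_inner_le_norm u x
    rw [hu] at this; linarith
  have hαx : inner ℝ u (x - u) = α := by rw [inner_sub_right, huu]
  rw [Set.mem_vadd_set_iff_neg_vadd_mem, vadd_eq_add, neg_add_eq_sub]
  refine ⟨(√σ)⁻¹ • (x - u - α • u) + (α / σ) • u, ?_, ?_⟩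
  · have h1 : inner ℝ (x - u - α • u) u = (0 : ℝ) := by
      rw [inner_sub_left, real_inner_comm, hαx, inner_smul_left, huu]; simp
    have h2 : ‖x - u‖ ^ 2 = ‖x - u - α • u‖ ^ 2 + α ^ 2 := by
      have h3 := norm_sub_sq_real (x - u) (α • u)
      rw [inner_smul_right, real_inner_comm, hαx, norm_smul, hu, mul_one, Real.norm_eq_abs,
        sq_abs] at h3
      linarith
    have h3 : ‖x - u‖ ^ 2 ≤ 2 * σ := by
      have := norm_sub_sq_real x u
      rw [real_inner_comm, hu] at this
      nlinarith [norm_nonneg x]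
    have h4 : ‖(√σ)⁻¹ • (x - u - α • u) + (α / σ) • u‖ ^ 2
        = σ⁻¹ * ‖x - u - α • u‖ ^ 2 + (α / σ) ^ 2 := by
      rw [norm_add_sq_real, inner_smul_left, inner_smul_right, h1, norm_smul, norm_smul, hu,
        mul_pow, mul_pow, norm_inv, Real.norm_eq_abs, Real.norm_eq_abs, inv_pow, sq_abs, sq_abs,
        sq √σ, hss]
      simp
    rw [mem_closedBall_zero_iff]
    have h5 : σ⁻¹ * ‖x - u - α • u‖ ^ 2 ≤ 2 := by
      rw [inv_mul_le_iff₀ hσ]; nlinarith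
    have h6 : (α / σ) ^ 2 ≤ 1 := by
      rw [div_pow, div_le_one (by positivity)]; nlinarith
    exact le_of_sq_le_sq (by rw [h4]; linarith) (by norm_num)
  · rw [capScale_apply]
    have h1 : inner ℝ u ((√σ)⁻¹ • (x - u - α • u) + (α / σ) • u) = α / σ := by
      rw [inner_add_right, inner_smul_right, inner_sub_right, hαx, inner_smul_right,
        inner_smul_right, huu]; simp
    rw [h1, smul_add, smul_add, smul_smul, smul_smul, smul_smul, mul_inv_cancel₀ hs.ne', one_smul]
    have : √σ * (α / σ) + √σ * (α / σ * (√σ - 1)) = α := by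
      field_simp; nlinarith
    rw [add_assoc, ← add_smul, this]
    abel

lemma subset_deepCap {u : E} (hu : ‖u‖ = 1) {σ : ℝ} (hσ : 0 < σ) (hσ1 : σ ≤ 1) :
    u +ᵥ (capScale u σ '' Metric.closedBall ((-3 / 16 : ℝ) • u) (1 / 16)) ⊆ deepCap u σ := by
  rintro _ ⟨_, ⟨w, hw, rfl⟩, rfl⟩
  have hs : 0 < √σ := Real.sqrt_pos.2 hσ
  have hss : √σ * √σ = σ := Real.mul_self_sqrt hσ.le
  have huu : inner ℝ u u = (1 : ℝ) := by rw [real_inner_self_eq_norm_sq, hu]; norm_num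
  set α : ℝ := inner ℝ u w with hα
  rw [mem_closedBall_iff_norm] at hw
  set y := w - (-3 / 16 : ℝ) • u with hy
  have hαy : inner ℝ u y = α + 3 / 16 := by
    rw [hy, inner_sub_right, inner_smul_right, huu]; ring
  have h1 : |α + 3 / 16| ≤ 1 / 16 := by
    have := abs_real_inner_le_norm u y
    rw [hαy, hu, one_mul] at this
    exact this.trans hw
  rw [abs_le] at h1
  have h2 : ‖w - α • u‖ ^ 2 ≤ 1 / 256 := by
    have h3 : w - α • u = y - (α + 3 / 16) • u := by rw [hy]; module
    have h4 := norm_sub_sq_real y ((α + 3 / 16) • u)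
    rw [inner_smul_right, real_inner_comm, hαy, norm_smul, hu, mul_one, Real.norm_eq_abs,
        sq_abs] at h4
    rw [h3, h4]
    nlinarith [norm_nonneg y]
  have h5 : u + capScale u σ w = √σ • (w - α • u) + (1 + σ * α) • u := by
    rw [capScale_apply, ← hα]
    have h9 : √σ * (α * (√σ - 1)) = σ * α - √σ * α := by linear_combination α * hss
    rw [smul_add, smul_smul, h9]
    module
  have h6 : inner ℝ (w - α • u) u = (0 : ℝ) := by
    rw [inner_sub_left, real_inner_comm, inner_smul_left, huu, ← hα]; simp
  have h7 : ‖u + capScale u σ w‖ ^ 2 = σ * ‖w - α • u‖ ^ 2 + (1 + σ * α) ^ 2 := by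
    rw [h5, norm_add_sq_real, inner_smul_left, inner_smul_right, h6, norm_smul, norm_smul, hu,
        mul_pow, mul_pow, Real.norm_eq_abs, Real.norm_eq_abs, sq_abs, sq_abs, sq √σ, hss]
    simp
  have h8 : inner ℝ u (u + capScale u σ w) = 1 + σ * α := by
    rw [h5, inner_add_right, inner_smul_right, real_inner_comm, h6, inner_smul_right, huu]; simp
  constructor
  · simp only [vadd_eq_add]
    have : ‖u + capScale u σ w‖ ≤ 1 - σ / 10 := by
      refine le_of_sq_le_sq ?_ (by linarith)
      rw [h7]
      nlinarith [mul_nonneg hσ.le (sub_nonneg.2 hσ1), mul_le_mul_of_nonneg_left h2 hσ.le,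
        mul_nonneg hσ.le (mul_nonneg (sub_nonneg.2 h1.1) (sub_nonneg.2 h1.2)),
        mul_nonneg (mul_nonneg hσ.le (sub_nonneg.2 hσ1)) (sq_nonneg α),
        mul_nonneg hσ.le (sub_nonneg.2 h1.1), mul_nonneg hσ.le (sub_nonneg.2 h1.2)]
    linarith
  · simp only [vadd_eq_add]
    rw [h8]
    nlinarith

lemma norm_le_one_of_mem_deepCap {u x : E} {σ : ℝ} (hσ : 0 ≤ σ) (hx : x ∈ deepCap u σ) :
    ‖x‖ ≤ 1 := by
  have := hx.1
  linarith

lemma one_sub_norm_le_of_mem_deepCap {u x : E} {σ : ℝ} (hu : ‖u‖ = 1) (hx : x ∈ deepCap u σ) :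
    1 - ‖x‖ ≤ σ / 4 := by
  have := real_inner_le_norm u x
  have := hx.2
  rw [hu] at *
  linarith

lemma mem_capNhd_of_mem_deepCap {u x y : E} {σ : ℝ} (hσ : 0 < σ) (hu : ‖u‖ = 1)
    (hx : x ∈ deepCap u σ) (hy : ‖y‖ ≤ 1) (hyu : 1 - inner ℝ u y ≤ 2 * σ) : y ∈ capNhd x := by
  refine ⟨hy, ?_⟩
  have := one_sub_inner_le hu (norm_le_one_of_mem_deepCap hσ.le hx) hy
  have := hx.1
  have := hx.2
  linarith

lemma capNhd_subset_ballCap {x : E} (hx : x ≠ 0) (hx1 : ‖x‖ ≤ 1) :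
    capNhd x ⊆ ballCap (‖x‖⁻¹ • x) (46 * (1 - ‖x‖)) := by
  rintro y ⟨hy, hxy⟩
  refine ⟨hy, ?_⟩
  have h0 : 0 < ‖x‖ := norm_pos_iff.2 hx
  have h1 : inner ℝ x y = ‖x‖ * inner ℝ (‖x‖⁻¹ • x) y := by
    rw [inner_smul_left]; simp [h0.ne']
  have h2 : |inner ℝ (‖x‖⁻¹ • x) y| ≤ (1 : ℝ) := by
    refine (abs_real_inner_le_norm _ _).trans ?_
    rw [norm_smul, norm_inv, norm_norm, inv_mul_cancel₀ h0.ne', one_mul]; exact hy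
  rw [abs_le] at h2
  nlinarith

end Caps

section BallLaw

open scoped Pointwise ENNReal
open Module (finrank)

lemma uniformDist_closedBall_apply {E : Type*} [NormedAddCommGroup E] [MeasureSpace E]
    {S : Set E} (hS : MeasurableSet S)
    (hS1 : S ⊆ Metric.closedBall 0 1) :
    uniformDist (Metric.closedBall (0 : E) 1) S
      = (volume (Metric.closedBall (0 : E) 1))⁻¹ * volume S := by
  rw [uniformDist, Measure.smul_apply, Measure.restrict_apply hS, smul_eq_mul,
    Set.inter_eq_left.2 hS1]

/-- The exponent `(dim E + 1) / 2` governing the volume of caps of the unit ball of `E`. -/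
def capExp (E : Type*) [AddCommGroup E] [Module ℝ E] : ℝ := ((finrank ℝ E : ℝ) + 1) / 2

variable {E : Type*} [NormedAddCommGroup E] [InnerProductSpace ℝ E]

lemma sqrt_pow_eq_rpow_capExp {σ : ℝ} (hσ : 0 ≤ σ) :
    √σ ^ (finrank ℝ E + 1) = σ ^ capExp E := by
  rw [Real.sqrt_eq_rpow, ← Real.rpow_natCast, ← Real.rpow_mul hσ, capExp]
  congr 1
  push_cast
  ring

lemma measurableSet_deepCap [MeasurableSpace E] [BorelSpace E] (u : E) (σ : ℝ) :
    MeasurableSet (deepCap u σ) :=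
  ((isClosed_le (g := fun y : E => 1 - ‖y‖) continuous_const (by fun_prop)).inter
    (isClosed_le (f := fun y => 1 - inner ℝ u y) (by fun_prop) continuous_const)).measurableSet

lemma measurableSet_ballCap [MeasurableSpace E] [BorelSpace E] (u : E) (σ : ℝ) :
    MeasurableSet (ballCap u σ) :=
  ((isClosed_le continuous_norm continuous_const).inter
    (isClosed_le (f := fun y => 1 - inner ℝ u y) (by fun_prop) continuous_const)).measurableSet

variable [FiniteDimensional ℝ E] [MeasureSpace E] [BorelSpace E]
  [(volume : Measure E).IsAddHaarMeasure]

lemma isProbabilityMeasure_uniformDist_closedBall {E : Type*} [NormedAddCommGroup E]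
    [InnerProductSpace ℝ E] [FiniteDimensional ℝ E] [MeasureSpace E]
    [(volume : Measure E).IsAddHaarMeasure] :
    IsProbabilityMeasure (uniformDist (Metric.closedBall (0 : E) 1)) := by
  refine ⟨?_⟩
  rw [uniformDist, Measure.smul_apply, Measure.restrict_apply_univ, smul_eq_mul]
  exact ENNReal.inv_mul_cancel (Metric.measure_closedBall_pos _ _ one_pos).ne'
    measure_closedBall_lt_top.ne

lemma volume_vadd_capScale_image {u : E} (hu : ‖u‖ = 1) {σ : ℝ} (hσ : 0 ≤ σ) (S : Set E) :
    volume (u +ᵥ (capScale u σ '' S)) = ENNReal.ofReal (σ ^ capExp E) * volume S := by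
  rw [measure_vadd, Measure.addHaar_image_linearMap, det_capScale hu,
    sqrt_pow_eq_rpow_capExp hσ, abs_of_nonneg (by positivity)]

variable (E) in
lemma exists_uniformDist_ballCap_le : ∃ C : ℝ, 0 < C ∧ ∀ u : E, ‖u‖ = 1 → ∀ σ : ℝ, 0 < σ →
    uniformDist (Metric.closedBall (0 : E) 1) (ballCap u σ) ≤ ENNReal.ofReal (C * σ ^ capExp E) := by
  set V := volume (Metric.closedBall (0 : E) 1)
  have hV0 : V ≠ 0 := (Metric.measure_closedBall_pos _ _ one_pos).ne'
  have hVt : V ≠ ∞ := measure_closedBall_lt_top.ne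
  set W := volume (Metric.closedBall (0 : E) 2)
  have hWt : W ≠ ∞ := measure_closedBall_lt_top.ne
  have hW0 : W ≠ 0 := (Metric.measure_closedBall_pos _ _ two_pos).ne'
  have hVWt : V⁻¹ * W ≠ ∞ := ENNReal.mul_ne_top (ENNReal.inv_ne_top.2 hV0) hWt
  refine ⟨(V⁻¹ * W).toReal, ENNReal.toReal_pos (mul_ne_zero (ENNReal.inv_ne_zero.2 hVt) hW0) hVWt,
    fun u hu σ hσ => ?_⟩
  rw [uniformDist_closedBall_apply (measurableSet_ballCap u σ)
    fun x hx => by simpa using hx.1, ENNReal.ofReal_mul ENNReal.toReal_nonneg,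
    ENNReal.ofReal_toReal hVWt, mul_assoc]
  gcongr
  rw [mul_comm, ← volume_vadd_capScale_image hu hσ.le]
  exact measure_mono (ballCap_subset hu hσ)

variable (E) in
lemma exists_le_uniformDist_deepCap : ∃ c : ℝ, 0 < c ∧ ∀ u : E, ‖u‖ = 1 → ∀ σ : ℝ, 0 < σ → σ ≤ 1 →
    ENNReal.ofReal (c * σ ^ capExp E) ≤ uniformDist (Metric.closedBall (0 : E) 1) (deepCap u σ) := by
  set V := volume (Metric.closedBall (0 : E) 1)
  have hV0 : V ≠ 0 := (Metric.measure_closedBall_pos _ _ one_pos).ne'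
  have hVt : V ≠ ∞ := measure_closedBall_lt_top.ne
  set W := volume (Metric.closedBall (0 : E) (1 / 16))
  have hWt : W ≠ ∞ := measure_closedBall_lt_top.ne
  have hW0 : W ≠ 0 := (Metric.measure_closedBall_pos _ _ (by norm_num)).ne'
  have hVWt : V⁻¹ * W ≠ ∞ := ENNReal.mul_ne_top (ENNReal.inv_ne_top.2 hV0) hWt
  refine ⟨(V⁻¹ * W).toReal, ENNReal.toReal_pos (mul_ne_zero (ENNReal.inv_ne_zero.2 hVt) hW0) hVWt,
    fun u hu σ hσ hσ1 => ?_⟩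
  rw [uniformDist_closedBall_apply (measurableSet_deepCap u σ)
    fun x hx => by simpa using norm_le_one_of_mem_deepCap hσ.le hx,
    ENNReal.ofReal_mul ENNReal.toReal_nonneg, ENNReal.ofReal_toReal hVWt, mul_assoc]
  gcongr
  rw [mul_comm, show W = volume (Metric.closedBall ((-3 / 16 : ℝ) • u) (1 / 16)) from
    (Measure.addHaar_closedBall_center _ _ _).symm, ← volume_vadd_capScale_image hu hσ.le]
  exact measure_mono (subset_deepCap hu hσ hσ1)

variable (E) in
lemma exists_uniformDist_capNhd_le : ∃ C : ℝ, 0 < C ∧ ∀ x : E, ‖x‖ < 1 →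
    uniformDist (Metric.closedBall (0 : E) 1) (capNhd x)
      ≤ ENNReal.ofReal (C * (1 - ‖x‖) ^ capExp E) := by
  obtain ⟨C, hC, h⟩ := exists_uniformDist_ballCap_le E
  refine ⟨max 1 (C * 46 ^ capExp E), by positivity, fun x hx => ?_⟩
  have h0 : 0 < 1 - ‖x‖ := by linarith
  rcases eq_or_ne x 0 with rfl | hx0
  · have := isProbabilityMeasure_uniformDist_closedBall (E := E)
    refine prob_le_one.trans ?_
    simp
  · refine (measure_mono (capNhd_subset_ballCap hx0 hx.le)).trans
      ((h _ (by simp [norm_smul, hx0]) _ (by positivity)).trans ?_)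
    rw [Real.mul_rpow (by norm_num) h0.le, ← mul_assoc]
    gcongr
    exact le_max_right _ _

lemma lintegral_fun_norm_addHaar [Nontrivial E] {f : ℝ → ℝ≥0∞} (hf : Measurable f) :
    ∫⁻ x : E, f ‖x‖ = finrank ℝ E * volume (Metric.ball (0 : E) 1) *
      ∫⁻ r in Set.Ioi (0 : ℝ), ENNReal.ofReal (r ^ (finrank ℝ E - 1)) * f r := by
  have hmp := (volume : Measure E).measurePreserving_homeomorphUnitSphereProd
  calc ∫⁻ x : E, f ‖x‖ = ∫⁻ x in ({0}ᶜ : Set E), f ‖x‖ := by rw [restrict_compl_singleton]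
    _ = ∫⁻ x : ({0}ᶜ : Set E), f ‖x.1‖ ∂((volume : Measure E).comap (↑)) := by
      rw [lintegral_subtype_comap (measurableSet_singleton _).compl (fun x => f ‖x‖)]
    _ = ∫⁻ z, f z.2 ∂(volume : Measure E).toSphere.prod (.volumeIoiPow (finrank ℝ E - 1)) := by
      simpa using hmp.lintegral_comp_emb (Homeomorph.measurableEmbedding _)
        (f ∘ Subtype.val ∘ Prod.snd)
    _ = (volume : Measure E).toSphere Set.univ *
        ∫⁻ r : Set.Ioi (0 : ℝ), f r ∂.volumeIoiPow (finrank ℝ E - 1) := by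
      rw [lintegral_prod _ (by fun_prop)]
      simp only [lintegral_const]
      rw [mul_comm]
    _ = _ := by
      rw [Measure.toSphere_apply_univ, Measure.volumeIoiPow,
        lintegral_withDensity_eq_lintegral_mul _ (by fun_prop) (by fun_prop)]
      simp only [Pi.mul_apply]
      rw [lintegral_subtype_comap measurableSet_Ioi
        (fun r => ENNReal.ofReal (r ^ (finrank ℝ E - 1)) * f r)]

lemma lintegral_uniformDist_closedBall [Nontrivial E] {f : ℝ → ℝ≥0∞} (hf : Measurable f) :
    ∫⁻ x, f (1 - ‖x‖) ∂uniformDist (Metric.closedBall (0 : E) 1) = finrank ℝ E *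
      ∫⁻ s in Set.Ioo (0 : ℝ) 1, ENNReal.ofReal ((1 - s) ^ (finrank ℝ E - 1)) * f s := by
  set V := volume (Metric.ball (0 : E) 1)
  have hV0 : V ≠ 0 := (Metric.measure_ball_pos _ _ one_pos).ne'
  have hVt : V ≠ ∞ := measure_ball_lt_top.ne
  have hV : volume (Metric.closedBall (0 : E) 1) = V := Measure.addHaar_closedBall_eq_addHaar_ball _ _ _
  have h1 : ∫⁻ x in Metric.closedBall (0 : E) 1, f (1 - ‖x‖)
      = ∫⁻ x : E, (Set.Iic 1).indicator (fun r => f (1 - r)) ‖x‖ := by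
    rw [← lintegral_indicator Metric.isClosed_closedBall.measurableSet]
    congr with x
    simp [Set.indicator]
  have h2 : ∫⁻ r in Set.Ioi (0 : ℝ), ENNReal.ofReal (r ^ (finrank ℝ E - 1)) *
        (Set.Iic 1).indicator (fun r => f (1 - r)) r
      = ∫⁻ s in Set.Ioo (0 : ℝ) 1, ENNReal.ofReal ((1 - s) ^ (finrank ℝ E - 1)) * f s := by
    rw [← lintegral_indicator measurableSet_Ioi, ← lintegral_indicator measurableSet_Ioo,
      ← lintegral_sub_left_eq_self (Set.indicator (Set.Ioi 0) _) (1 : ℝ)]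
    refine lintegral_congr_ae ?_
    filter_upwards [compl_mem_ae_iff.2 (measure_singleton (0 : ℝ))] with s hs
    have hs' : s ≠ 0 := hs
    by_cases h : s < 1 <;> by_cases h' : 0 ≤ s
    · have : 0 < s := lt_of_le_of_ne h' hs'.symm
      simp [Set.indicator, h, h', this]
    · have : ¬ 0 < s := fun h => h' h.le
      simp [Set.indicator, h', this]
    · simp [Set.indicator, h]
    · simp [Set.indicator, h]
  rw [uniformDist, lintegral_smul_measure, h1, lintegral_fun_norm_addHaar
    ((show Measurable fun r : ℝ => f (1 - r) by fun_prop).indicator measurableSet_Iic), h2, hV, smul_eq_mul,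
    mul_comm (finrank ℝ E : ℝ≥0∞) V, mul_assoc, ← mul_assoc, ENNReal.inv_mul_cancel hV0 hVt, one_mul]

lemma ae_norm_lt_one [Nontrivial E] : ∀ᵐ x ∂uniformDist (Metric.closedBall (0 : E) 1), ‖x‖ < 1 := by
  rw [uniformDist]
  refine Measure.ae_smul_measure ?_ _
  have h1 : ∀ᵐ x ∂(volume.restrict (Metric.closedBall (0 : E) 1)), x ∈ Metric.closedBall (0 : E) 1 :=
    ae_restrict_mem Metric.isClosed_closedBall.measurableSet
  have h2 : ∀ᵐ x ∂(volume.restrict (Metric.closedBall (0 : E) 1)), x ∉ Metric.sphere (0 : E) 1 :=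
    ae_restrict_of_ae (measure_eq_zero_iff_ae_notMem.1 (Measure.addHaar_sphere _ _ _))
  filter_upwards [h1, h2] with x h1 h2
  simp at h1 h2
  exact lt_of_le_of_ne h1 h2

end BallLaw

section ProdCap

open scoped ENNReal
open Module (finrank)

variable {E : Type*} [NormedAddCommGroup E] [InnerProductSpace ℝ E]
  {F : Type*} [NormedAddCommGroup F] [InnerProductSpace ℝ F]

/-- The order of magnitude of the minimal volume of a cap of the product of the unit balls of `E`
and `F` that contains `z`. -/
def capWeight (z : E × F) : ℝ := (1 - ‖z.1‖) ^ capExp E * (1 - ‖z.2‖) ^ capExp F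

lemma capExp_pos : 0 < capExp E := by unfold capExp; positivity

lemma measurable_capWeight [MeasurableSpace E] [BorelSpace E] [MeasurableSpace F] [BorelSpace F] :
    Measurable (capWeight : E × F → ℝ) := by
  unfold capWeight
  fun_prop

lemma capWeight_pos {z : E × F} (h1 : ‖z.1‖ < 1) (h2 : ‖z.2‖ < 1) : 0 < capWeight z :=
  mul_pos (Real.rpow_pos_of_pos (by linarith) _) (Real.rpow_pos_of_pos (by linarith) _)

lemma exists_unit_smul_eq [Nontrivial E] (a : E) : ∃ u : E, ‖u‖ = 1 ∧ a = ‖a‖ • u := by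
  rcases eq_or_ne a 0 with rfl | ha
  · obtain ⟨u, hu⟩ := exists_norm_eq E zero_le_one
    exact ⟨u, hu, by simp⟩
  · exact ⟨‖a‖⁻¹ • a, by simp [norm_smul, ha], by simp [smul_smul, ha]⟩

lemma exists_cap_height {a h : ℝ} (hh : 0 < h) :
    ∃ σ : ℝ, 0 < σ ∧ σ ≤ 1 ∧ a * σ ≤ h ∧ ∀ t ≤ 2, a * t ≤ h → t ≤ 2 * σ := by
  rcases le_or_gt a h with hah | hah
  · exact ⟨1, one_pos, le_rfl, by linarith, fun t ht _ => by linarith⟩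
  · have ha0 : 0 < a := hh.trans hah
    refine ⟨h / a, by positivity, (div_le_one ha0).2 hah.le, (mul_div_cancel₀ _ ha0.ne').le,
      fun t _ ht => ?_⟩
    have : t ≤ h / a := by rw [le_div_iff₀ ha0]; linarith
    have : 0 < h / a := by positivity
    linarith

/-- The points that share a cap of volume comparable to `capWeight z` with `z`. -/
def prodCapNhd (z : E × F) : Set (E × F) := capNhd z.1 ×ˢ capNhd z.2

lemma isClosed_setOf_mem_prodCapNhd : IsClosed {q : (E × F) × (E × F) | q.1 ∈ prodCapNhd q.2} := by
  have h : {q : (E × F) × (E × F) | q.1 ∈ prodCapNhd q.2} =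
      ({q | ‖q.1.1‖ ≤ 1} ∩ {q | 1 - inner ℝ q.2.1 q.1.1 ≤ 45 * (1 - ‖q.2.1‖)}) ∩
      ({q | ‖q.1.2‖ ≤ 1} ∩ {q | 1 - inner ℝ q.2.2 q.1.2 ≤ 45 * (1 - ‖q.2.2‖)}) := by
    ext; rfl
  rw [h]
  exact ((isClosed_le (by fun_prop) (by fun_prop)).inter
    (isClosed_le (by fun_prop) (by fun_prop))).inter ((isClosed_le (by fun_prop) (by fun_prop)).inter
    (isClosed_le (by fun_prop) (by fun_prop)))

variable [FiniteDimensional ℝ E] [MeasureSpace E] [BorelSpace E]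
  [(volume : Measure E).IsAddHaarMeasure] [Nontrivial E]
  [FiniteDimensional ℝ F] [MeasureSpace F] [BorelSpace F]
  [(volume : Measure F).IsAddHaarMeasure] [Nontrivial F]

variable (E F) in
/-- The uniform distribution on the product of the unit balls. -/
abbrev prodBallLaw : Measure (E × F) :=
  (uniformDist (Metric.closedBall (0 : E) 1)).prod (uniformDist (Metric.closedBall (0 : F) 1))

instance : IsProbabilityMeasure (uniformDist (Metric.closedBall (0 : E) 1)) :=
  isProbabilityMeasure_uniformDist_closedBall

lemma ae_prodBallLaw_norm_lt_one : ∀ᵐ z ∂prodBallLaw E F, ‖z.1‖ < 1 ∧ ‖z.2‖ < 1 := by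
  have h1 := Measure.quasiMeasurePreserving_fst (μ := uniformDist (Metric.closedBall (0 : E) 1))
    (ν := uniformDist (Metric.closedBall (0 : F) 1)) |>.ae ae_norm_lt_one
  have h2 := Measure.quasiMeasurePreserving_snd (μ := uniformDist (Metric.closedBall (0 : E) 1))
    (ν := uniformDist (Metric.closedBall (0 : F) 1)) |>.ae ae_norm_lt_one
  exact h1.and h2

variable (E F) in
lemma exists_prodBallLaw_prodCapNhd_le : ∃ C : ℝ, 0 < C ∧ ∀ z : E × F, ‖z.1‖ < 1 → ‖z.2‖ < 1 →
    prodBallLaw E F (prodCapNhd z) ≤ ENNReal.ofReal (C * capWeight z) := by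
  obtain ⟨C, hC, h⟩ := exists_uniformDist_capNhd_le E
  obtain ⟨D, hD, h'⟩ := exists_uniformDist_capNhd_le F
  refine ⟨C * D, by positivity, fun z h1 h2 => ?_⟩
  rw [prodCapNhd, Measure.prod_prod, capWeight, mul_mul_mul_comm, ENNReal.ofReal_mul]
  · exact mul_le_mul' (h _ h1) (h' _ h2)
  · have : 0 ≤ 1 - ‖z.1‖ := by linarith
    positivity

/-- Bound on the probability that a cap is empty by an integral over the points in the cap. -/
lemma emptyCap_le_lintegral {c : ℝ} {Z U T : Set (E × F)} (hZ : MeasurableSet Z)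
    (hZU : Disjoint Z U) (hZ0 : prodBallLaw E F Z ≠ 0)
    (h : ∀ z ∈ Z, ‖z.1‖ < 1 ∧ ‖z.2‖ < 1 ∧ T ⊆ prodCapNhd z ∧
        ENNReal.ofReal (c * capWeight z) ≤ prodBallLaw E F Z) (j : ℕ) :
    prodBallLaw E F U ^ j ≤ ∫⁻ z in {z | T ⊆ prodCapNhd z},
      (ENNReal.ofReal (c * capWeight z))⁻¹ * ENNReal.ofReal (Real.exp (-(j * (c * capWeight z))))
        ∂prodBallLaw E F := by
  set ν := prodBallLaw E F
  have h1 : ν U ≤ ENNReal.ofReal (Real.exp (-(ν Z).toReal)) := by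
    have : ν U ≤ 1 - ν Z := by
      rw [← prob_compl_eq_one_sub hZ]
      exact measure_mono (Set.subset_compl_iff_disjoint_left.2 hZU)
    refine this.trans ?_
    rw [← ENNReal.ofReal_toReal (measure_ne_top ν Z), ← ENNReal.ofReal_one,
      ← ENNReal.ofReal_sub _ ENNReal.toReal_nonneg, ENNReal.toReal_ofReal ENNReal.toReal_nonneg]
    refine ENNReal.ofReal_le_ofReal ?_
    have := Real.add_one_le_exp (-(ν Z).toReal)
    linarith
  have h2 : ν U ^ j ≤ ENNReal.ofReal (Real.exp (-(j * (ν Z).toReal))) := by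
    refine (pow_le_pow_left' h1 j).trans ?_
    rw [← ENNReal.ofReal_pow (Real.exp_pos _).le, ← Real.exp_nat_mul]
    simp
  calc ν U ^ j = ∫⁻ z in Z, (ν Z)⁻¹ * ν U ^ j ∂ν := by
        rw [setLIntegral_const, mul_right_comm, ENNReal.inv_mul_cancel hZ0 (measure_ne_top _ _),
          one_mul]
    _ ≤ ∫⁻ z in Z, (ENNReal.ofReal (c * capWeight z))⁻¹ *
          ENNReal.ofReal (Real.exp (-(j * (c * capWeight z)))) ∂ν := by
        refine setLIntegral_mono' hZ fun z hz => ?_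
        obtain ⟨z1, z2, -, z4⟩ := h z hz
        gcongr
        refine h2.trans (ENNReal.ofReal_le_ofReal (Real.exp_le_exp.2 (neg_le_neg ?_)))
        have := capWeight_pos z1 z2
        gcongr
        exact (ENNReal.ofReal_le_iff_le_toReal (measure_ne_top _ _)).1 z4
    _ ≤ _ := lintegral_mono_set fun z hz => (h z hz).2.2.1

variable (E F) in
/-- Every cap of a product of two balls has a subset of comparable volume from each of whose points
the whole base of the cap is visible. -/
lemma exists_visible_subset : ∃ c : ℝ, 0 < c ∧ ∀ (a : E) (b : F) (r : ℝ) (T : Set (E × F)),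
    (a, b) ≠ 0 → T.Nonempty → (∀ z ∈ T, ‖z.1‖ < 1 ∧ ‖z.2‖ < 1 ∧ inner ℝ a z.1 + inner ℝ b z.2 = r) →
    ∃ Z : Set (E × F), MeasurableSet Z ∧ (∀ z ∈ Z, r < inner ℝ a z.1 + inner ℝ b z.2) ∧
      prodBallLaw E F Z ≠ 0 ∧
      ∀ z ∈ Z, ‖z.1‖ < 1 ∧ ‖z.2‖ < 1 ∧ T ⊆ prodCapNhd z ∧
        ENNReal.ofReal (c * capWeight z) ≤ prodBallLaw E F Z := by
  obtain ⟨c₁, hc₁, h₁⟩ := exists_le_uniformDist_deepCap E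
  obtain ⟨c₂, hc₂, h₂⟩ := exists_le_uniformDist_deepCap F
  refine ⟨c₁ * c₂, by positivity, fun a b r T hab ⟨t, ht⟩ hT => ?_⟩
  obtain ⟨u, hu, hau⟩ := exists_unit_smul_eq a
  obtain ⟨w, hw, hbw⟩ := exists_unit_smul_eq b
  have hax : ∀ x, inner ℝ a x = ‖a‖ * inner ℝ u x := fun x => by
    conv_lhs => rw [hau, inner_smul_left]
    simp
  have hby : ∀ x, inner ℝ b x = ‖b‖ * inner ℝ w x := fun x => by
    conv_lhs => rw [hbw, inner_smul_left]
    simp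
  have hux : ∀ x : E, ‖x‖ ≤ 1 → inner ℝ u x ≤ ‖x‖ ∧ -‖x‖ ≤ inner ℝ u x := fun x hx => by
    have := abs_real_inner_le_norm u x
    rw [hu, one_mul, abs_le] at this
    exact ⟨this.2, this.1⟩
  have hwy : ∀ y : F, ‖y‖ ≤ 1 → inner ℝ w y ≤ ‖y‖ ∧ -‖y‖ ≤ inner ℝ w y := fun y hy => by
    have := abs_real_inner_le_norm w y
    rw [hw, one_mul, abs_le] at this
    exact ⟨this.2, this.1⟩
  have hh : 0 < ‖a‖ + ‖b‖ - r := by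
    obtain ⟨t1, t2, t3⟩ := hT t ht
    rw [hax, hby] at t3
    have e1 := (hux _ t1.le).1
    have e2 := (hwy _ t2.le).1
    have : 0 < ‖a‖ ∨ 0 < ‖b‖ := by
      by_contra! h
      exact hab (Prod.ext (norm_le_zero_iff.1 h.1) (norm_le_zero_iff.1 h.2))
    rcases this with h | h <;>
      nlinarith [mul_nonneg (norm_nonneg a) (sub_nonneg.2 (e1.trans t1.le)),
        mul_nonneg (norm_nonneg b) (sub_nonneg.2 (e2.trans t2.le))]
  obtain ⟨σ, hσ, hσ1, hσa, hσt⟩ := exists_cap_height (a := ‖a‖) hh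
  obtain ⟨τ, hτ, hτ1, hτb, hτt⟩ := exists_cap_height (a := ‖b‖) hh
  have hν : ENNReal.ofReal (c₁ * σ ^ capExp E) * ENNReal.ofReal (c₂ * τ ^ capExp F) ≤
      prodBallLaw E F (deepCap u σ ×ˢ deepCap w τ) := by
    rw [Measure.prod_prod]
    exact mul_le_mul' (h₁ u hu σ hσ hσ1) (h₂ w hw τ hτ hτ1)
  rw [← ENNReal.ofReal_mul (by positivity)] at hν
  refine ⟨deepCap u σ ×ˢ deepCap w τ, (measurableSet_deepCap u σ).prod (measurableSet_deepCap w τ),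
    ?_, ?_, ?_⟩
  · rintro ⟨x, y⟩ ⟨hx, hy⟩
    have e1 := hx.2
    have e2 := hy.2
    simp only [] at e1 e2 ⊢
    rw [hax, hby]
    nlinarith [mul_le_mul_of_nonneg_left e1 (norm_nonneg a),
      mul_le_mul_of_nonneg_left e2 (norm_nonneg b)]
  · refine (lt_of_lt_of_le ?_ hν).ne'
    rw [ENNReal.ofReal_pos]
    positivity
  · rintro ⟨x, y⟩ ⟨hx, hy⟩
    have e1 : ‖x‖ < 1 := by have := hx.1; simp only at this; linarith
    have e2 : ‖y‖ < 1 := by have := hy.1; simp only at this; linarith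
    refine ⟨e1, e2, ?_, ?_⟩
    · rintro ⟨x', y'⟩ hz
      obtain ⟨t1, t2, t3⟩ := hT _ hz
      simp only at t1 t2 t3
      have f1 := hux x' t1.le
      have f2 := hwy y' t2.le
      rw [hax, hby] at t3
      refine ⟨mem_capNhd_of_mem_deepCap hσ hu hx t1.le (hσt _ (by linarith) ?_),
        mem_capNhd_of_mem_deepCap hτ hw hy t2.le (hτt _ (by linarith) ?_)⟩
      · nlinarith [mul_nonneg (norm_nonneg b) (show 0 ≤ 1 - inner ℝ w y' by linarith)]
      · nlinarith [mul_nonneg (norm_nonneg a) (show 0 ≤ 1 - inner ℝ u x' by linarith)]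
    · refine le_trans (ENNReal.ofReal_le_ofReal ?_) hν
      have g1 := one_sub_norm_le_of_mem_deepCap hu hx
      have g2 := one_sub_norm_le_of_mem_deepCap hw hy
      simp only at g1 g2
      rw [mul_mul_mul_comm, capWeight]
      have p1 := (capExp_pos (E := E)).le
      have p2 := (capExp_pos (E := F)).le
      have : 0 ≤ 1 - ‖x‖ := by linarith
      have : 0 ≤ 1 - ‖y‖ := by linarith
      simp only
      gcongr <;> linarith

end ProdCap

section Facets

open Module (finrank)

variable {E : Type*} [NormedAddCommGroup E] [NormedSpace ℝ E]
  {ι : Type*} [Fintype ι]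

/-- The points `x i`, `i ∈ I`, lie on a hyperplane and all other points strictly on one side. -/
def OneSided (x : ι → E) (I : Finset ι) : Prop :=
  ∃ (l : E →L[ℝ] ℝ) (c : ℝ), (∀ i ∈ I, l (x i) = c) ∧ ∀ j ∉ I, l (x j) ≤ c - 1

/-- The point `x i` is the unique maximizer of a linear functional among all points. -/
def ExposedAt (x : ι → E) (i : ι) : Prop :=
  ∃ l : E →L[ℝ] ℝ, ∀ j ≠ i, l (x j) < l (x i)

/-- Any `finrank ℝ E + 1` of the points are affinely independent. -/
def InGeneralPosition (x : ι → E) : Prop :=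
  ∀ s : Finset ι, s.card = finrank ℝ E + 1 → AffineIndependent ℝ fun i : s => x i

lemma oneSided_of_lt {x : ι → E} {I : Finset ι} {l : E →L[ℝ] ℝ} {c : ℝ}
    (h1 : ∀ i ∈ I, l (x i) = c) (h2 : ∀ j ∉ I, l (x j) < c) : OneSided x I := by
  obtain ⟨δ, hδ, h⟩ : ∃ δ > 0, ∀ j ∉ I, l (x j) ≤ c - δ := by
    classical
    rcases (Finset.univ \ I).eq_empty_or_nonempty with h0 | h0
    · exact ⟨1, one_pos, fun j hj => absurd (Finset.mem_sdiff.2 ⟨Finset.mem_univ j, hj⟩)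
        (by simp [h0])⟩
    · obtain ⟨j, hj, hmin⟩ := Finset.exists_min_image (Finset.univ \ I) (fun j => c - l (x j)) h0
      refine ⟨c - l (x j), sub_pos.2 (h2 j (by simpa using hj)), fun i hi => ?_⟩
      have := hmin i (by simpa using hi)
      linarith
  refine ⟨δ⁻¹ • l, δ⁻¹ * c, fun i hi => by simp [h1 i hi], fun j hj => ?_⟩
  have := mul_le_mul_of_nonneg_left (h j hj) (inv_nonneg.2 hδ.le)
  rw [mul_sub, inv_mul_cancel₀ hδ.ne'] at this
  simpa using this

lemma convexHull_image_of_isExtreme {ι : Type*} {x : ι → E} {F : Set E}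
    (hF : IsExtreme ℝ (convexHull ℝ (Set.range x)) F) (hc : Convex ℝ F) :
    F = convexHull ℝ (x '' {i | x i ∈ F}) := by
  refine Set.Subset.antisymm (fun y hy => ?_) (convexHull_min ?_ hc)
  · set A := x '' {i | x i ∈ F}
    set B := x '' {i | x i ∉ F}
    have hAB : Set.range x = A ∪ B := by
      rw [← Set.image_union, ← Set.image_univ]
      congr 1
      ext i
      simp [em]
    have hB : convexHull ℝ B ⊆ convexHull ℝ (Set.range x) \ F := by
      refine convexHull_min ?_ (hF.convex_sdiff (convex_convexHull ℝ _))
      rintro _ ⟨i, hi, rfl⟩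
      exact ⟨subset_convexHull ℝ _ ⟨i, rfl⟩, hi⟩
    have hyK := hF.subset hy
    rcases B.eq_empty_or_nonempty with h0 | h0
    · rwa [hAB, h0, Set.union_empty] at hyK
    rcases A.eq_empty_or_nonempty with h1 | h1
    · rw [hAB, h1, Set.empty_union] at hyK
      exact absurd hy (hB hyK).2
    rw [hAB, convexHull_union h1 h0, mem_convexJoin] at hyK
    obtain ⟨a, ha, b, hb, hab⟩ := hyK
    have haK : a ∈ convexHull ℝ (Set.range x) :=
      convexHull_mono (hAB ▸ Set.subset_union_left) ha
    rw [← insert_endpoints_openSegment] at hab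
    rcases hab with rfl | rfl | hab
    · exact ha
    · exact absurd hy (hB hb).2
    · exact absurd (hF.right_mem_of_mem_openSegment haK (hB hb).1 hy hab) (hB hb).2
  · rintro _ ⟨i, hi, rfl⟩
    exact hi

lemma vectorSpan_convexHull_eq (s : Set E) :
    vectorSpan ℝ (convexHull ℝ s) = vectorSpan ℝ s := by
  rw [← direction_affineSpan, ← direction_affineSpan, affineSpan_convexHull]

lemma InGeneralPosition.affineIndependent {x : ι → E} (hx : InGeneralPosition x)
    (hn : finrank ℝ E + 1 ≤ Fintype.card ι) {s : Finset ι} (hs : s.card ≤ finrank ℝ E + 1) :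
    AffineIndependent ℝ fun i : s => x i := by
  obtain ⟨t, hst, ht⟩ := Finset.exists_superset_card_eq hs hn
  exact (hx t ht).comp_embedding ⟨Set.inclusion hst, Set.inclusion_injective hst⟩

variable [FiniteDimensional ℝ E] {x : ι → E}

lemma InGeneralPosition.finrank_vectorSpan (hx : InGeneralPosition x)
    (hn : finrank ℝ E + 1 ≤ Fintype.card ι) {s : Finset ι} {m : ℕ} (hm : s.card = m + 1)
    (hs : m ≤ finrank ℝ E) : finrank ℝ (vectorSpan ℝ (x '' s)) = m := by
  have := (hx.affineIndependent hn (s := s) (by omega)).finrank_vectorSpan (n := m) (by simpa)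
  rw [Set.image_eq_range]
  exact this

lemma InGeneralPosition.card_le_of_forall_eq (hx : InGeneralPosition x)
    (hn : finrank ℝ E + 1 ≤ Fintype.card ι) {s : Finset ι} {l : E →L[ℝ] ℝ} {c : ℝ} (hl : l ≠ 0)
    (h : ∀ i ∈ s, l (x i) = c) : s.card ≤ finrank ℝ E := by
  by_contra! hs
  obtain ⟨t, hts, ht⟩ := Finset.exists_subset_card_eq (Nat.succ_le_of_lt hs)
  have h1 := hx.finrank_vectorSpan hn ht le_rfl
  have h2 : vectorSpan ℝ (x '' t) ≤ LinearMap.ker (l : E →ₗ[ℝ] ℝ) := by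
    rw [vectorSpan, Submodule.span_le]
    rintro _ ⟨_, ⟨i, hi, rfl⟩, _, ⟨j, hj, rfl⟩, rfl⟩
    simp [h i (hts hi), h j (hts hj)]
  rw [Submodule.eq_top_of_finrank_eq h1, top_le_iff, LinearMap.ker_eq_top] at h2
  exact hl (by ext v; exact LinearMap.congr_fun h2 v)

lemma InGeneralPosition.interior_nonempty (hx : InGeneralPosition x)
    (hn : finrank ℝ E + 1 ≤ Fintype.card ι) :
    (interior (convexHull ℝ (Set.range x))).Nonempty := by
  rw [interior_convexHull_nonempty_iff_affineSpan_eq_top]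
  obtain ⟨t, -, ht⟩ := Finset.exists_superset_card_eq (s := (∅ : Finset ι)) (by simp) hn
  have h1 := Submodule.eq_top_of_finrank_eq (hx.finrank_vectorSpan hn ht le_rfl)
  have : Nonempty ι := Fintype.card_pos_iff.1 (by omega)
  rw [AffineSubspace.affineSpan_eq_top_iff_vectorSpan_eq_top_of_nonempty ℝ E E
    (Set.range_nonempty x), ← top_le_iff, ← h1]
  exact vectorSpan_mono ℝ (Set.image_subset_range _ _)

lemma IsExtreme.eq_of_mem_interior {E : Type*} [NormedAddCommGroup E] [NormedSpace ℝ E]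
    {K F : Set E} (hF : IsExtreme ℝ K F) {z : E} (hz : z ∈ F)
    (hzK : z ∈ interior K) : F = K := by
  refine hF.subset.antisymm fun y hy => ?_
  have h1 : Tendsto (fun t : ℝ => z + t • (z - y)) (nhdsWithin 0 (Set.Ioi 0)) (nhds z) := by
    have : Continuous fun t : ℝ => z + t • (z - y) := by fun_prop
    simpa using (this.tendsto 0).mono_left nhdsWithin_le_nhds
  obtain ⟨t, ht, ht0⟩ :=
    ((h1.eventually (mem_interior_iff_mem_nhds.1 hzK)).and self_mem_nhdsWithin).exists
  have ht0 : 0 < t := ht0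
  refine hF.left_mem_of_mem_openSegment hy ht hz ⟨t / (1 + t), 1 / (1 + t), by positivity,
    by positivity, by field_simp; ring, ?_⟩
  have e : z + t • (z - y) = (1 + t) • z - t • y := by module
  rw [e, smul_sub, smul_smul, smul_smul, one_div_mul_cancel (by positivity), one_smul, div_mul_comm,
    mul_one, ← sub_eq_zero]
  match_scalars <;> field_simp <;> ring

open Classical in
/-- The indices of the points that lie on a facet. -/
lemma InGeneralPosition.oneSided_of_facet (hx : InGeneralPosition x)
    (hn : finrank ℝ E + 1 ≤ Fintype.card ι) {F : Set E} (h0 : F.Nonempty) (hc : Convex ℝ F)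
    (hF : IsExtreme ℝ (convexHull ℝ (Set.range x)) F) (hE : 0 < finrank ℝ E)
    (hd : finrank ℝ (vectorSpan ℝ F) = finrank ℝ E - 1) :
    (Finset.univ.filter fun i => x i ∈ F).card = finrank ℝ E ∧
      OneSided x (Finset.univ.filter fun i => x i ∈ F) := by
  set I := Finset.univ.filter fun i => x i ∈ F with hI
  have hFI : F = convexHull ℝ (x '' I) := by
    simpa [hI] using convexHull_image_of_isExtreme hF hc
  have hdI : finrank ℝ (vectorSpan ℝ (x '' (I : Set ι))) = finrank ℝ E - 1 := by
    rw [← hd]; conv_rhs => rw [hFI]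
    rw [vectorSpan_convexHull_eq]
  have hI1 : finrank ℝ E ≤ I.card := by
    have hpos : I.Nonempty := by
      by_contra! h
      rw [hFI, h] at h0
      simp at h0
    have := finrank_vectorSpan_image_finset_le ℝ x I (n := I.card - 1)
      (by have := hpos.card_pos; omega)
    rw [Finset.coe_image, hdI] at this
    have := hpos.card_pos
    omega
  have hint := hx.interior_nonempty hn
  have hdisj : Disjoint (interior (convexHull ℝ (Set.range x))) F := by
    rw [Set.disjoint_left]
    intro z hz hzF
    have := hF.eq_of_mem_interior hzF hz
    rw [this] at hd
    rw [interior_convexHull_nonempty_iff_affineSpan_eq_top] at hint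
    rw [vectorSpan_convexHull_eq, ← direction_affineSpan, hint, AffineSubspace.direction_top,
      finrank_top] at hd
    omega
  obtain ⟨l, c, hl, hK, hFc⟩ := geometric_hahn_banach_of_nonempty_interior (convex_convexHull ℝ _)
    hc hdisj hint h0
  have hle : ∀ i, l (x i) ≤ c := fun i => hK _ (subset_convexHull ℝ _ ⟨i, rfl⟩)
  set J := Finset.univ.filter fun i => l (x i) = c with hJ
  have hIJ : I ⊆ J := fun i hi => by
    simp only [hI, hJ, Finset.mem_filter_univ] at hi ⊢
    exact le_antisymm (hle i) (hFc _ hi)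
  have hJc : J.card ≤ finrank ℝ E := hx.card_le_of_forall_eq hn hl (c := c) (by simp [hJ])
  have hIJ' : I = J := Finset.eq_of_subset_of_card_le hIJ (hJc.trans hI1)
  refine ⟨le_antisymm (hIJ' ▸ hJc) hI1, ?_⟩
  rw [hIJ']
  refine oneSided_of_lt (l := l) (c := c) (by simp [hJ]) fun j hj => lt_of_le_of_ne (hle j) ?_
  simpa [hJ] using hj

lemma InGeneralPosition.exists_facet (hx : InGeneralPosition x)
    (hn : finrank ℝ E + 1 ≤ Fintype.card ι) {I : Finset ι} (hI : I.card = finrank ℝ E)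
    (hE : 0 < finrank ℝ E) (hs : OneSided x I) :
    ∃ F : Set E, (F.Nonempty ∧ Convex ℝ F ∧ IsExtreme ℝ (convexHull ℝ (Set.range x)) F ∧
      finrank ℝ (vectorSpan ℝ F) = finrank ℝ E - 1) ∧ ∀ i, x i ∈ F ↔ i ∈ I := by
  obtain ⟨l, c, h1, h2⟩ := hs
  have hle : ∀ y ∈ convexHull ℝ (Set.range x), l y ≤ c := by
    refine fun y hy => convexHull_min (t := {y | l y ≤ c}) ?_
      (convex_halfSpace_le l.toLinearMap.isLinear c) hy
    rintro _ ⟨i, rfl⟩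
    by_cases hi : i ∈ I
    · exact (h1 i hi).le
    · exact (h2 i hi).trans (by linarith)
  obtain ⟨i₀, hi₀⟩ : I.Nonempty := Finset.card_pos.1 (by omega)
  have hmem : ∀ i, x i ∈ l.toExposed (convexHull ℝ (Set.range x)) ↔ i ∈ I := by
    intro i
    constructor
    · intro h
      by_contra hi
      have e1 := h.2 (x i₀) (subset_convexHull ℝ _ ⟨i₀, rfl⟩)
      rw [h1 i₀ hi₀] at e1
      linarith [h2 i hi]
    · exact fun h => ⟨subset_convexHull ℝ _ ⟨i, rfl⟩, fun y hy => (h1 i h).symm ▸ hle y hy⟩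
  have hexp : IsExposed ℝ (convexHull ℝ (Set.range x)) (l.toExposed (convexHull ℝ (Set.range x))) :=
    ContinuousLinearMap.toExposed.isExposed
  have hconv := hexp.convex (convex_convexHull ℝ _)
  refine ⟨l.toExposed (convexHull ℝ (Set.range x)), ⟨⟨x i₀, (hmem i₀).2 hi₀⟩, hconv,
    hexp.isExtreme, ?_⟩, hmem⟩
  rw [convexHull_image_of_isExtreme hexp.isExtreme hconv, vectorSpan_convexHull_eq]
  rw [show {i | x i ∈ l.toExposed (convexHull ℝ (Set.range x))} = (I : Set ι) from Set.ext hmem]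
  exact hx.finrank_vectorSpan hn (s := I) (by omega) (by omega)

open Classical in
/-- For points in general position, facets correspond to one-sided subsets. -/
lemma InGeneralPosition.faceCount_eq (hx : InGeneralPosition x)
    (hn : finrank ℝ E + 1 ≤ Fintype.card ι) (hE : 0 < finrank ℝ E) :
    faceCount (convexHull ℝ (Set.range x)) (finrank ℝ E - 1) =
      ((Finset.univ.powersetCard (finrank ℝ E)).filter fun I => OneSided x I).card := by
  rw [faceCount, ← Nat.card_eq_finsetCard]
  have hmem : ∀ F : {F : Set E // F.Nonempty ∧ Convex ℝ F ∧
      IsExtreme ℝ (convexHull ℝ (Set.range x)) F ∧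
      finrank ℝ (vectorSpan ℝ F) = finrank ℝ E - 1}, (Finset.univ.filter fun i => x i ∈ F.1) ∈
      (Finset.univ.powersetCard (finrank ℝ E)).filter fun I => OneSided x I := by
    rintro ⟨F, h0, hc, hF, hd⟩
    obtain ⟨h1, h2⟩ := hx.oneSided_of_facet hn h0 hc hF hE hd
    simpa using ⟨h1, h2⟩
  refine Nat.card_eq_of_bijective
    (fun F => ⟨Finset.univ.filter fun i => x i ∈ F.1, hmem F⟩) ⟨fun F G h => ?_, fun I => ?_⟩
  · have h' : {i | x i ∈ F.1} = {i | x i ∈ G.1} := by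
      ext i
      simpa using Finset.ext_iff.1 (congrArg Subtype.val h) i
    refine Subtype.ext ?_
    rw [convexHull_image_of_isExtreme F.2.2.2.1 F.2.2.1,
      convexHull_image_of_isExtreme G.2.2.2.1 G.2.2.1, h']
  · obtain ⟨I, hI⟩ := I
    obtain ⟨hI1, hI2⟩ := Finset.mem_filter.1 hI
    obtain ⟨F, hF, hFI⟩ := hx.exists_facet hn (Finset.mem_powersetCard.1 hI1).2 hE hI2
    exact ⟨⟨F, hF⟩, Subtype.ext (by ext i; simp [hFI])⟩

lemma InGeneralPosition.exists_contact (hx : InGeneralPosition x)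
    (hn : finrank ℝ E + 1 ≤ Fintype.card ι) (hE : 0 < finrank ℝ E) {i : ι} (hi : ExposedAt x i)
    (m : ℕ) (hm : m < finrank ℝ E) :
    ∃ (l : E →L[ℝ] ℝ) (I : Finset ι), l ≠ 0 ∧ i ∈ I ∧ m < I.card ∧ (∀ j ∈ I, l (x j) = l (x i)) ∧
      ∀ j, l (x j) ≤ l (x i) := by
  classical
  induction m with
  | zero =>
    obtain ⟨l, hl⟩ := hi
    refine ⟨l, {i}, ?_, by simp, by simp, by simp, fun j => ?_⟩
    · rintro rfl
      obtain ⟨j, hj⟩ := Fintype.exists_ne_of_one_lt_card (show 1 < Fintype.card ι by omega) i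
      simpa using hl j hj
    · rcases eq_or_ne j i with rfl | hj
      · exact le_rfl
      · exact (hl j hj).le
  | succ m ih =>
    obtain ⟨l, I, hl, hiI, hI, h1, h2⟩ := ih (by omega)
    by_cases hmore : ∃ j ∉ I, l (x j) = l (x i)
    · obtain ⟨j, hj, hji⟩ := hmore
      refine ⟨l, insert j I, hl, Finset.mem_insert_of_mem hiI, ?_, ?_, h2⟩
      · rw [Finset.card_insert_of_notMem hj]
        omega
      · intro a ha
        rcases Finset.mem_insert.1 ha with rfl | ha
        · exact hji
        · exact h1 a ha
    by_cases hIm : m + 1 < I.card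
    · exact ⟨l, I, hl, hiI, hIm, h1, h2⟩
    have hIm : I.card = m + 1 := by omega
    have hlt : ∀ j ∉ I, l (x j) < l (x i) := fun j hj =>
      lt_of_le_of_ne (h2 j) fun h => hmore ⟨j, hj, h⟩
    obtain ⟨v, hv⟩ : ∃ v, l v ≠ 0 := by
      by_contra! h
      exact hl (by ext v; exact h v)
    have hW := hx.finrank_vectorSpan hn hIm (by omega)
    have hlt_top : vectorSpan ℝ (x '' I) ⊔ Submodule.span ℝ {v} < ⊤ := by
      refine Submodule.lt_top_of_finrank_lt_finrank ?_
      have e1 := Submodule.finrank_add_le_finrank_add_finrank (vectorSpan ℝ (x '' I))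
        (Submodule.span ℝ {v})
      have e2 := finrank_span_singleton (K := ℝ) (v := v) (by rintro rfl; simp at hv)
      omega
    obtain ⟨f, hf, hfker⟩ := Submodule.exists_le_ker_of_lt_top _ hlt_top
    have hfv : f v = 0 := hfker (Submodule.mem_sup_right (Submodule.mem_span_singleton_self v))
    have hfI : ∀ j ∈ I, f (x j) = f (x i) := fun j hj => by
      have : f (x j - x i) = 0 := hfker (Submodule.mem_sup_left
        (vsub_mem_vectorSpan ℝ (Set.mem_image_of_mem x hj) (Set.mem_image_of_mem x hiI)))
      rwa [map_sub, sub_eq_zero] at this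
    obtain ⟨g, hg, hgv, hgI, j, hgj⟩ : ∃ g : E →L[ℝ] ℝ, g ≠ 0 ∧ g v = 0 ∧
        (∀ j ∈ I, g (x j) = g (x i)) ∧ ∃ j, g (x i) < g (x j) := by
      have hg0 : f.toContinuousLinearMap ≠ 0 := by simpa using hf
      obtain ⟨j, hj⟩ : ∃ j, f (x j) ≠ f (x i) := by
        by_contra! h
        have := hx.card_le_of_forall_eq hn (s := Finset.univ) (c := f (x i)) hg0 (by simpa using h)
        rw [Finset.card_univ] at this
        omega
      rcases lt_or_gt_of_ne hj with hj | hj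
      · exact ⟨-f.toContinuousLinearMap, neg_ne_zero.2 hg0, by simp [hfv],
          fun a ha => by simp [hfI a ha], j, by simpa using hj⟩
      · exact ⟨f.toContinuousLinearMap, hg0, by simp [hfv], fun a ha => by simp [hfI a ha], j,
          by simpa using hj⟩
    obtain ⟨j, hj, hmin⟩ := Finset.exists_min_image
      (Finset.univ.filter fun j => g (x i) < g (x j))
      (fun j => (l (x i) - l (x j)) / (g (x j) - g (x i))) ⟨j, by simpa using hgj⟩
    simp only [Finset.mem_filter_univ] at hj hmin
    have hjI : j ∉ I := fun h => by rw [hgI j h] at hj; exact lt_irrefl _ hj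
    set t := (l (x i) - l (x j)) / (g (x j) - g (x i)) with ht
    have ht0 : 0 < t := div_pos (sub_pos.2 (hlt j hjI)) (sub_pos.2 hj)
    refine ⟨l + t • g, insert j I, ?_, Finset.mem_insert_of_mem hiI, ?_, ?_, fun a => ?_⟩
    · intro h
      have := congrArg (fun φ : E →L[ℝ] ℝ => φ v) h
      simp [hgv, hv] at this
    · rw [Finset.card_insert_of_notMem hjI]
      omega
    · intro a ha
      rcases Finset.mem_insert.1 ha with rfl | ha
      · have := div_mul_cancel₀ (l (x i) - l (x a)) (sub_pos.2 hj).ne'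
        rw [← ht] at this
        simp only [add_apply, smul_apply, smul_eq_mul]
        linarith
      · simp [h1 a ha, hgI a ha]
    · simp only [add_apply, smul_apply, smul_eq_mul]
      rcases lt_or_ge (g (x i)) (g (x a)) with hga | hga
      · have := (le_div_iff₀ (sub_pos.2 hga)).1 (hmin a hga)
        linarith
      · nlinarith [h2 a]

lemma InGeneralPosition.exists_oneSided (hx : InGeneralPosition x)
    (hn : finrank ℝ E + 1 ≤ Fintype.card ι) (hE : 0 < finrank ℝ E) {i : ι} (hi : ExposedAt x i) :
    ∃ I : Finset ι, I.card = finrank ℝ E ∧ i ∈ I ∧ OneSided x I := by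
  classical
  obtain ⟨l, I, hl, hiI, hI, h1, h2⟩ := hx.exists_contact hn hE hi (finrank ℝ E - 1) (by omega)
  set J := Finset.univ.filter fun j => l (x j) = l (x i) with hJ
  have hIJ : I ⊆ J := fun j hj => by simpa [hJ] using h1 j hj
  have hJc : J.card ≤ finrank ℝ E := hx.card_le_of_forall_eq hn hl (c := l (x i)) (by simp [hJ])
  have := Finset.card_le_card hIJ
  refine ⟨J, by omega, hIJ hiI, oneSided_of_lt (l := l) (c := l (x i)) (by simp [hJ]) fun j hj =>
    lt_of_le_of_ne (h2 j) ?_⟩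
  simpa [hJ] using hj

end Facets

section GeneralPosition

open Module (finrank)

lemma measurableSet_exists_of_isClosed {P X : Type*} [TopologicalSpace P] [SigmaCompactSpace P]
    [TopologicalSpace X] [MeasurableSpace X] [OpensMeasurableSpace X] {C : Set (P × X)}
    (hC : IsClosed C) : MeasurableSet {x | ∃ p, (p, x) ∈ C} := by
  have : {x | ∃ p, (p, x) ∈ C} = ⋃ n : ℕ, Prod.snd ''
      ((fun q : compactCovering P n × X => ((q.1 : P), q.2)) ⁻¹' C) := by
    ext x
    simp only [Set.mem_ofPred_eq, Set.mem_iUnion, Set.mem_image, Set.mem_preimage]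
    constructor
    · rintro ⟨p, hp⟩
      obtain ⟨n, hn⟩ := exists_mem_compactCovering p
      exact ⟨n, (⟨p, hn⟩, x), hp, rfl⟩
    · rintro ⟨n, q, hq, rfl⟩
      exact ⟨q.1, hq⟩
  rw [this]
  refine MeasurableSet.iUnion fun n => ?_
  have : CompactSpace (compactCovering P n) :=
    isCompact_iff_compactSpace.1 (isCompact_compactCovering P n)
  exact (isClosedMap_snd_of_compactSpace _ (hC.preimage (by fun_prop))).measurableSet

variable {E : Type*} [NormedAddCommGroup E] [NormedSpace ℝ E] [FiniteDimensional ℝ E]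
  [MeasurableSpace E] [BorelSpace E] {ι : Type*} [Fintype ι]

lemma measurableSet_oneSided (I : Finset ι) : MeasurableSet {x : ι → E | OneSided x I} := by
  have : FiniteDimensional ℝ (E →L[ℝ] ℝ) := inferInstance
  have : ProperSpace (E →L[ℝ] ℝ) := FiniteDimensional.proper_real _
  have hC : IsClosed {q : ((E →L[ℝ] ℝ) × ℝ) × (ι → E) |
      (∀ i ∈ I, q.1.1 (q.2 i) = q.1.2) ∧ ∀ j ∉ I, q.1.1 (q.2 j) ≤ q.1.2 - 1} := by
    simp only [Set.ofPred_and, Set.ofPred_forall]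
    refine IsClosed.inter (isClosed_iInter fun i => isClosed_iInter fun _ => ?_)
      (isClosed_iInter fun i => isClosed_iInter fun _ => ?_)
    · exact isClosed_eq (by fun_prop) (by fun_prop)
    · exact isClosed_le (by fun_prop) (by fun_prop)
  convert measurableSet_exists_of_isClosed hC using 1
  ext x
  simp [OneSided]

lemma ae_affineIndependent_fin {ν : Measure E} [IsProbabilityMeasure ν]
    (hν : ∀ s : AffineSubspace ℝ E, s ≠ ⊤ → ν s = 0) (m : ℕ) (hm : m ≤ finrank ℝ E + 1) :
    ∀ᵐ x ∂Measure.pi fun _ : Fin m => ν, AffineIndependent ℝ x := by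
  induction m with
  | zero => exact .of_forall fun x => affineIndependent_of_subsingleton ℝ x
  | succ m ih =>
    have hmp := measurePreserving_piFinSuccAbove (fun _ : Fin (m + 1) => ν) 0
    have hmeas : MeasurableSet {x : Fin (m + 1) → E | AffineIndependent ℝ x} :=
      isOpen_setOfPred_affineIndependent.measurableSet
    set e := MeasurableEquiv.piFinSuccAbove (fun _ : Fin (m + 1) => E) 0
    have key : ∀ᵐ q ∂ν.prod (Measure.pi fun _ : Fin m => ν), AffineIndependent ℝ (e.symm q) := by
      have hS : MeasurableSet {q | AffineIndependent ℝ (e.symm q)} := e.symm.measurable hmeas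
      rw [Measure.ae_prod_iff_ae_ae hS, Measure.ae_ae_comm (p := fun z y => AffineIndependent ℝ (e.symm (z, y))) hS]
      filter_upwards [ih (by omega)] with y hy
      have hspan : affineSpan ℝ (Set.range y) ≠ ⊤ := by
        intro h
        rcases isEmpty_or_nonempty (Fin m) with h0 | h0
        · rw [Set.range_eq_empty, AffineSubspace.span_empty] at h
          exact bot_ne_top h
        · have h1 := finrank_vectorSpan_range_add_one_le ℝ y
          rw [← direction_affineSpan, h, AffineSubspace.direction_top, finrank_top,
            Fintype.card_fin] at h1
          omega
      filter_upwards [measure_eq_zero_iff_ae_notMem.1 (hν _ hspan)] with z hz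
      have hcons : e.symm (z, y) = Fin.cons z y := by
        simp [e, MeasurableEquiv.piFinSuccAbove, Fin.insertNthEquiv]
      rw [hcons]
      refine AffineIndependent.affineIndependent_of_notMem_span (i := 0) ?_ ?_
      · rw [← affineIndependent_equiv (finSuccAboveEquiv (0 : Fin (m + 1)))]
        have : (fun i : {i : Fin (m + 1) // i ≠ 0} => (Fin.cons z y : Fin (m + 1) → E) i) ∘
            finSuccAboveEquiv 0 = y := by
          ext i
          change (Fin.cons z y : Fin (m + 1) → E) ((0 : Fin (m + 1)).succAbove i) = y i
          rw [Fin.succAbove_zero, Fin.cons_succ]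
        rw [this]
        exact hy
      · have : (Fin.cons z y : Fin (m + 1) → E) '' {i | i ≠ 0} = Set.range y := by
          ext v
          simp only [Set.mem_image, Set.mem_range, Set.mem_ofPred_eq]
          constructor
          · rintro ⟨i, hi, rfl⟩
            obtain ⟨j, rfl⟩ := Fin.exists_succ_eq.2 hi
            exact ⟨j, by simp⟩
          · rintro ⟨j, rfl⟩
            exact ⟨j.succ, Fin.succ_ne_zero j, by simp⟩
        rw [this, Fin.cons_zero]
        exact hz
    have := hmp.quasiMeasurePreserving.ae key
    filter_upwards [this] with x hx
    simpa using hx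

lemma ae_affineIndependent {ν : Measure E} [IsProbabilityMeasure ν]
    (hν : ∀ s : AffineSubspace ℝ E, s ≠ ⊤ → ν s = 0) (hm : Fintype.card ι ≤ finrank ℝ E + 1) :
    ∀ᵐ x ∂Measure.pi fun _ : ι => ν, AffineIndependent ℝ x := by
  have h := measurePreserving_piCongrLeft (fun _ : Fin (Fintype.card ι) => ν) (Fintype.equivFin ι)
  filter_upwards [h.quasiMeasurePreserving.ae (ae_affineIndependent_fin hν _ hm)] with x hx
  rw [← affineIndependent_equiv (Fintype.equivFin ι)] at hx
  convert hx using 1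
  ext i
  simp [MeasurableEquiv.piCongrLeft, Equiv.piCongrLeft]

lemma ae_inGeneralPosition {ν : Measure E} [IsProbabilityMeasure ν]
    (hν : ∀ s : AffineSubspace ℝ E, s ≠ ⊤ → ν s = 0) :
    ∀ᵐ x ∂Measure.pi fun _ : ι => ν, InGeneralPosition x := by
  classical
  simp only [InGeneralPosition]
  rw [ae_all_iff]
  intro s
  rw [ae_all_iff]
  intro hs
  have h := (measurePreserving_piEquivPiSubtypeProd (fun _ : ι => ν)
    (fun i => i ∈ s)).quasiMeasurePreserving
  refine h.ae (Measure.quasiMeasurePreserving_fst.ae ?_)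
  convert ae_affineIndependent (ι := s) hν (by simp [hs])

open Classical in
/-- The expected number of facets is the sum of the probabilities that a set of points spans a
facet. -/
lemma integral_faceCount {ν : Measure E} [IsProbabilityMeasure ν]
    (hν : ∀ s : AffineSubspace ℝ E, s ≠ ⊤ → ν s = 0)
    (hn : finrank ℝ E + 1 ≤ Fintype.card ι) (hE : 0 < finrank ℝ E) :
    ∫ x : ι → E, (faceCount (convexHull ℝ (Set.range x)) (finrank ℝ E - 1) : ℝ)
      ∂(Measure.pi fun _ => ν) =
    ∑ I ∈ Finset.univ.powersetCard (finrank ℝ E),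
      (Measure.pi fun _ : ι => ν).real {x | OneSided x I} := by
  have h1 : ∀ᵐ x : ι → E ∂Measure.pi fun _ => ν,
      (faceCount (convexHull ℝ (Set.range x)) (finrank ℝ E - 1) : ℝ) =
      ∑ I ∈ Finset.univ.powersetCard (finrank ℝ E),
        Set.indicator {x : ι → E | OneSided x I} (fun _ => (1 : ℝ)) x := by
    filter_upwards [ae_inGeneralPosition hν] with x hx
    rw [hx.faceCount_eq hn hE, Finset.card_filter]
    push_cast
    rfl
  rw [integral_congr_ae h1, integral_finsetSum]
  · refine Finset.sum_congr rfl fun I _ => ?_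
    rw [integral_indicator_const _ (measurableSet_oneSided I)]
    simp
  · exact fun I _ => (integrable_const 1).indicator (measurableSet_oneSided I)

/-- Every exposed point lies on a facet, which has `finrank ℝ E` vertices. -/
lemma integral_faceCount_ge {ν : Measure E} [IsProbabilityMeasure ν]
    (hν : ∀ s : AffineSubspace ℝ E, s ≠ ⊤ → ν s = 0)
    (hn : finrank ℝ E + 1 ≤ Fintype.card ι) (hE : 0 < finrank ℝ E) {A : ι → Set (ι → E)}
    (hA : ∀ i, MeasurableSet (A i)) (h : ∀ i, ∀ᵐ x ∂Measure.pi fun _ => ν, x ∈ A i → ExposedAt x i) :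
    ∑ i, (Measure.pi fun _ : ι => ν).real (A i) ≤ finrank ℝ E *
      ∫ x : ι → E, (faceCount (convexHull ℝ (Set.range x)) (finrank ℝ E - 1) : ℝ)
        ∂(Measure.pi fun _ => ν) := by
  classical
  rw [integral_faceCount hν hn hE, Finset.mul_sum]
  have h1 : ∀ᵐ x : ι → E ∂Measure.pi fun _ => ν,
      ∑ i, Set.indicator (A i) (fun _ => (1 : ℝ)) x ≤
      ∑ I ∈ Finset.univ.powersetCard (finrank ℝ E),
        finrank ℝ E * Set.indicator {x : ι → E | OneSided x I} (fun _ => (1 : ℝ)) x := by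
    filter_upwards [ae_inGeneralPosition hν, ae_all_iff.2 h] with x hx hex
    have e1 : ∑ i, Set.indicator (A i) (fun _ => (1 : ℝ)) x =
        ((Finset.univ.filter fun i => x ∈ A i).card : ℝ) := by
      rw [Finset.card_filter]
      push_cast
      rfl
    have e2 : ∑ I ∈ Finset.univ.powersetCard (finrank ℝ E),
        finrank ℝ E * Set.indicator {x : ι → E | OneSided x I} (fun _ => (1 : ℝ)) x =
        ((((Finset.univ.powersetCard (finrank ℝ E)).filter fun I => OneSided x I).card *
          finrank ℝ E : ℕ) : ℝ) := by
      rw [← Finset.mul_sum, Finset.card_filter]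
      push_cast
      rw [mul_comm]
      rfl
    rw [e1, e2]
    norm_cast
    refine le_trans (Finset.card_le_card ?_) (Finset.card_biUnion_le_card_mul
      ((Finset.univ.powersetCard (finrank ℝ E)).filter fun I => OneSided x I) id _
      fun I hI => (Finset.mem_powersetCard.1 (Finset.mem_filter.1 hI).1).2.le)
    intro i hi
    obtain ⟨I, hI, hiI, hs⟩ := hx.exists_oneSided hn hE (hex i (by simpa using hi))
    simp only [Finset.mem_biUnion, Finset.mem_filter, Finset.mem_powersetCard_univ, id]
    exact ⟨I, ⟨hI, hs⟩, hiI⟩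
  have h2 := integral_mono_ae (integrable_finsetSum _ fun i _ =>
    (integrable_const (1 : ℝ)).indicator (hA i)) (integrable_finsetSum _ fun I _ =>
      ((integrable_const (1 : ℝ)).indicator (measurableSet_oneSided I)).const_mul _) h1
  rw [integral_finsetSum _ fun i _ => (integrable_const (1 : ℝ)).indicator (hA i),
    integral_finsetSum _ fun I _ =>
      ((integrable_const (1 : ℝ)).indicator (measurableSet_oneSided I)).const_mul _] at h2
  simp_rw [integral_const_mul, integral_indicator_const (1 : ℝ) (measurableSet_oneSided _),
    integral_indicator_const (1 : ℝ) (hA _), smul_eq_mul, mul_one] at h2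
  exact h2

end GeneralPosition

section UpperBound

open scoped ENNReal
open Module (finrank)

variable {E : Type*} [NormedAddCommGroup E] [InnerProductSpace ℝ E] [FiniteDimensional ℝ E]
  [MeasureSpace E] [BorelSpace E] [(volume : Measure E).IsAddHaarMeasure] [Nontrivial E]
  {F : Type*} [NormedAddCommGroup F] [InnerProductSpace ℝ F] [FiniteDimensional ℝ F]
  [MeasureSpace F] [BorelSpace F] [(volume : Measure F).IsAddHaarMeasure] [Nontrivial F]

variable (E F) in
lemma uniformDist_prod_eq : uniformDist (Metric.closedBall (0 : E) 1 ×ˢ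
    Metric.closedBall (0 : F) 1) = prodBallLaw E F := by
  have h1 : volume (Metric.closedBall (0 : E) 1) ≠ ∞ := measure_closedBall_lt_top.ne
  have h2 : volume (Metric.closedBall (0 : F) 1) ≠ ∞ := measure_closedBall_lt_top.ne
  rw [prodBallLaw, uniformDist, uniformDist, uniformDist, Measure.volume_eq_prod,
    Measure.prod_prod, Measure.prod_smul_left, Measure.prod_smul_right, Measure.prod_restrict,
    smul_smul, ENNReal.mul_inv (Or.inr h2) (Or.inl h1)]

lemma uniformDist_absolutelyContinuous {α : Type*} [MeasureSpace α] (K : Set α) :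
    uniformDist K ≪ volume :=
  Measure.smul_absolutelyContinuous.trans Measure.restrict_le_self.absolutelyContinuous

lemma prodBallLaw_affineSubspace (s : AffineSubspace ℝ (E × F)) (hs : s ≠ ⊤) :
    prodBallLaw E F s = 0 :=
  (uniformDist_absolutelyContinuous _).prod (uniformDist_absolutelyContinuous _)
    (Measure.addHaar_affineSubspace ((volume : Measure E).prod (volume : Measure F)) s hs)

omit [MeasureSpace E] [BorelSpace E] [(volume : Measure E).IsAddHaarMeasure] [Nontrivial E]
  [MeasureSpace F] [BorelSpace F] [(volume : Measure F).IsAddHaarMeasure] [Nontrivial F] in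
lemma exists_inner_eq (l : E × F →ₗ[ℝ] ℝ) :
    ∃ (a : E) (b : F), ∀ z, l z = inner ℝ a z.1 + inner ℝ b z.2 := by
  have : CompleteSpace E := FiniteDimensional.complete ℝ E
  have : CompleteSpace F := FiniteDimensional.complete ℝ F
  refine ⟨(InnerProductSpace.toDual ℝ E).symm (l ∘ₗ LinearMap.inl ℝ E F).toContinuousLinearMap,
    (InnerProductSpace.toDual ℝ F).symm (l ∘ₗ LinearMap.inr ℝ E F).toContinuousLinearMap,
    fun z => ?_⟩
  simp [InnerProductSpace.toDual_symm_apply, ← map_add]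

omit [MeasureSpace E] [BorelSpace E] [(volume : Measure E).IsAddHaarMeasure] [Nontrivial E]
  [MeasureSpace F] [BorelSpace F] [(volume : Measure F).IsAddHaarMeasure] [Nontrivial F] in
/-- The hyperplane through an affinely independent family of `finrank ℝ (E × F)` points. -/
lemma exists_hyperplane {κ : Type*} [Fintype κ] [Nonempty κ] {z : κ → E × F}
    (hz : AffineIndependent ℝ z) (hκ : Fintype.card κ = finrank ℝ (E × F)) :
    ∃ (a : E) (b : F) (r : ℝ), (a, b) ≠ 0 ∧ (∀ i, inner ℝ a (z i).1 + inner ℝ b (z i).2 = r) ∧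
      ∀ (l : E × F →L[ℝ] ℝ) (c : ℝ), (∀ i, l (z i) = c) →
        ∃ t : ℝ, c = t * r ∧ ∀ y, l y = t * (inner ℝ a y.1 + inner ℝ b y.2) := by
  have hV := hz.finrank_vectorSpan_add_one
  obtain ⟨f, hf, hker⟩ := Submodule.exists_le_ker_of_lt_top (vectorSpan ℝ (Set.range z))
    (Submodule.lt_top_of_finrank_lt_finrank (by omega))
  have hker' : vectorSpan ℝ (Set.range z) = LinearMap.ker f := by
    refine Submodule.eq_of_le_of_finrank_eq hker ?_
    have := Module.Dual.finrank_ker_add_one_of_ne_zero hf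
    omega
  obtain ⟨a, b, hab⟩ := exists_inner_eq f
  obtain ⟨i₀⟩ := ‹Nonempty κ›
  obtain ⟨v, hv⟩ : ∃ v, f v ≠ 0 := by
    by_contra! h
    exact hf (LinearMap.ext h)
  refine ⟨a, b, f (z i₀), ?_, fun i => ?_, fun l c hl => ⟨l v / f v, ?_⟩⟩
  · intro h
    rw [Prod.mk_eq_zero] at h
    exact hv (by rw [hab, h.1, h.2]; simp)
  · rw [← hab, ← sub_eq_zero, ← map_sub]
    exact hker (vsub_mem_vectorSpan ℝ ⟨i, rfl⟩ ⟨i₀, rfl⟩)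
  · have key : ∀ y, l y = l v / f v * f y := by
      intro y
      have h1 : y - (f y / f v) • v ∈ vectorSpan ℝ (Set.range z) := by
        rw [hker', LinearMap.mem_ker, map_sub, map_smul, smul_eq_mul, div_mul_cancel₀ _ hv, sub_self]
      have h2 : vectorSpan ℝ (Set.range z) ≤ LinearMap.ker (l : E × F →ₗ[ℝ] ℝ) := by
        rw [vectorSpan, Submodule.span_le]
        rintro _ ⟨_, ⟨i, rfl⟩, _, ⟨j, rfl⟩, rfl⟩
        simp [hl]
      have h3 : l (y - (f y / f v) • v) = 0 := h2 h1
      rw [map_sub, map_smul, smul_eq_mul, sub_eq_zero] at h3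
      rw [h3]
      ring
    exact ⟨by rw [← hl i₀, key], fun y => by rw [key, hab y]⟩

/-- The probability that `j` further points lie on one side of the hyperplane through an affinely
independent family. -/
lemma measure_oneSided_fiber_le {c : ℝ}
    (hvis : ∀ (a : E) (b : F) (r : ℝ) (T : Set (E × F)),
      (a, b) ≠ 0 → T.Nonempty →
      (∀ z ∈ T, ‖z.1‖ < 1 ∧ ‖z.2‖ < 1 ∧ inner ℝ a z.1 + inner ℝ b z.2 = r) →
      ∃ Z : Set (E × F), MeasurableSet Z ∧ (∀ z ∈ Z, r < inner ℝ a z.1 + inner ℝ b z.2) ∧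
        prodBallLaw E F Z ≠ 0 ∧
        ∀ z ∈ Z, ‖z.1‖ < 1 ∧ ‖z.2‖ < 1 ∧ T ⊆ prodCapNhd z ∧
          ENNReal.ofReal (c * capWeight z) ≤ prodBallLaw E F Z)
    {κ : Type*} [Fintype κ] [Nonempty κ] {z : κ → E × F} (hz : AffineIndependent ℝ z)
    (hκ : Fintype.card κ = finrank ℝ (E × F)) (hz1 : ∀ i, ‖(z i).1‖ < 1 ∧ ‖(z i).2‖ < 1)
    {κ' : Type*} [Fintype κ'] [Nonempty κ'] {S : Set (κ' → E × F)}
    (hS : ∀ w ∈ S, ∃ (l : E × F →L[ℝ] ℝ) (s : ℝ), (∀ i, l (z i) = s) ∧ ∀ j, l (w j) ≤ s - 1) :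
    (Measure.pi fun _ : κ' => prodBallLaw E F) S ≤ 2 * ∫⁻ ζ in {ζ | ∀ i, z i ∈ prodCapNhd ζ},
      (ENNReal.ofReal (c * capWeight ζ))⁻¹ *
        ENNReal.ofReal (Real.exp (-(Fintype.card κ' * (c * capWeight ζ)))) ∂prodBallLaw E F := by
  obtain ⟨a, b, r, hab, hr, huniq⟩ := exists_hyperplane hz hκ
  have side : ∀ (a : E) (b : F) (r : ℝ), (a, b) ≠ 0 →
      (∀ i, inner ℝ a (z i).1 + inner ℝ b (z i).2 = r) →
      (Measure.pi fun _ : κ' => prodBallLaw E F)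
        (Set.pi Set.univ fun _ => {y | inner ℝ a y.1 + inner ℝ b y.2 ≤ r}) ≤
      ∫⁻ ζ in {ζ | ∀ i, z i ∈ prodCapNhd ζ}, (ENNReal.ofReal (c * capWeight ζ))⁻¹ *
        ENNReal.ofReal (Real.exp (-(Fintype.card κ' * (c * capWeight ζ)))) ∂prodBallLaw E F := by
    intro a b r hab hr
    obtain ⟨Z, hZ, hZr, hZ0, hZv⟩ := hvis a b r (Set.range z) hab (Set.range_nonempty z)
      (by rintro _ ⟨i, rfl⟩; exact ⟨(hz1 i).1, (hz1 i).2, hr i⟩)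
    have hdisj : Disjoint Z {y | inner ℝ a y.1 + inner ℝ b y.2 ≤ r} :=
      Set.disjoint_left.2 fun y hy hy' => not_lt.2 hy' (hZr y hy)
    have := emptyCap_le_lintegral hZ hdisj hZ0 hZv (Fintype.card κ')
    rw [Measure.pi_pi, Finset.prod_const, Finset.card_univ]
    simpa only [Set.range_subset_iff] using this
  have h2 := side (-a) (-b) (-r) (by simpa using hab) fun i => by
    simp only [inner_neg_left, ← hr i]; ring
  rw [two_mul]
  refine (measure_mono (fun w hw => ?_)).trans ((measure_union_le _ _).trans
    (add_le_add (side a b r hab hr) h2))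
  obtain ⟨l, s, hl, hls⟩ := hS w hw
  obtain ⟨t, hst, ht⟩ := huniq l s hl
  have h3 : ∀ j, t * (inner ℝ a (w j).1 + inner ℝ b (w j).2) ≤ t * r - 1 := fun j => by
    rw [← ht, ← hst]; exact hls j
  rcases le_or_gt 0 t with h0 | h0
  · refine Or.inl fun j _ => ?_
    by_contra! h
    simp only [Set.mem_ofPred_eq, not_le] at h
    nlinarith [h3 j]
  · refine Or.inr fun j _ => ?_
    simp only [Set.mem_ofPred_eq, inner_neg_left]
    by_contra! h
    nlinarith [h3 j]

end UpperBound

section UpperBoundSum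

open scoped ENNReal
open Module (finrank)

variable {E : Type*} [NormedAddCommGroup E] [InnerProductSpace ℝ E] [FiniteDimensional ℝ E]
  [MeasureSpace E] [BorelSpace E] [(volume : Measure E).IsAddHaarMeasure] [Nontrivial E]
  {F : Type*} [NormedAddCommGroup F] [InnerProductSpace ℝ F] [FiniteDimensional ℝ F]
  [MeasureSpace F] [BorelSpace F] [(volume : Measure F).IsAddHaarMeasure] [Nontrivial F]

lemma finrank_prod_pos {E F : Type*} [NormedAddCommGroup E] [InnerProductSpace ℝ E]
    [FiniteDimensional ℝ E] [Nontrivial E] [NormedAddCommGroup F] [InnerProductSpace ℝ F]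
    [FiniteDimensional ℝ F] [Nontrivial F] : 0 < finrank ℝ (E × F) := by
  rw [Module.finrank_prod]
  have := Module.finrank_pos (R := ℝ) (M := E)
  omega

omit [FiniteDimensional ℝ E] [(volume : Measure E).IsAddHaarMeasure] [Nontrivial E]
  [FiniteDimensional ℝ F] [(volume : Measure F).IsAddHaarMeasure] [Nontrivial F] in
lemma measurable_capIntegrand (c t : ℝ) : Measurable fun ζ : E × F =>
    (ENNReal.ofReal (c * capWeight ζ))⁻¹ *
      ENNReal.ofReal (Real.exp (-(t * (c * capWeight ζ)))) := by
  have := measurable_capWeight (E := E) (F := F)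
  fun_prop

lemma lintegral_prodCapNhd_le {κ : Type*} [Fintype κ] {g : E × F → ℝ≥0∞} (hg : Measurable g) {C : ℝ}
    (hC : ∀ z : E × F, ‖z.1‖ < 1 → ‖z.2‖ < 1 →
      prodBallLaw E F (prodCapNhd z) ≤ ENNReal.ofReal (C * capWeight z)) :
    ∫⁻ z : κ → E × F, ∫⁻ ζ in {ζ | ∀ i, z i ∈ prodCapNhd ζ}, g ζ ∂prodBallLaw E F
        ∂(Measure.pi fun _ => prodBallLaw E F) ≤
      ∫⁻ ζ, g ζ * ENNReal.ofReal (C * capWeight ζ) ^ Fintype.card κ ∂prodBallLaw E F := by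
  have hcl : IsClosed {q : (κ → E × F) × (E × F) | ∀ i, q.1 i ∈ prodCapNhd q.2} := by
    rw [Set.ofPred_forall]
    refine isClosed_iInter fun i => ?_
    exact isClosed_setOf_mem_prodCapNhd.preimage
      (f := fun q : (κ → E × F) × (E × F) => (q.1 i, q.2)) (by fun_prop)
  have hm := hcl.measurableSet
  have h1 : ∀ z : κ → E × F, ∫⁻ ζ in {ζ | ∀ i, z i ∈ prodCapNhd ζ}, g ζ ∂prodBallLaw E F =
      ∫⁻ ζ, Set.indicator {q : (κ → E × F) × (E × F) | ∀ i, q.1 i ∈ prodCapNhd q.2}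
        (fun q => g q.2) (z, ζ) ∂prodBallLaw E F := by
    intro z
    have hmz : MeasurableSet {ζ : E × F | ∀ i, z i ∈ prodCapNhd ζ} := measurable_prodMk_left hm
    rw [← lintegral_indicator hmz]
    rfl
  simp_rw [h1]
  rw [lintegral_lintegral_swap (f := fun z ζ => Set.indicator
    {q : (κ → E × F) × (E × F) | ∀ i, q.1 i ∈ prodCapNhd q.2} (fun q => g q.2) (z, ζ))
    ((hg.comp measurable_snd).indicator hm).aemeasurable]
  refine lintegral_mono_ae ?_
  filter_upwards [ae_prodBallLaw_norm_lt_one] with ζ hζ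
  have h2 : ∫⁻ z : κ → E × F, Set.indicator
      {q : (κ → E × F) × (E × F) | ∀ i, q.1 i ∈ prodCapNhd q.2} (fun q => g q.2) (z, ζ)
        ∂(Measure.pi fun _ => prodBallLaw E F) =
      g ζ * prodBallLaw E F (prodCapNhd ζ) ^ Fintype.card κ := by
    have : ∀ z : κ → E × F, Set.indicator
        {q : (κ → E × F) × (E × F) | ∀ i, q.1 i ∈ prodCapNhd q.2} (fun q => g q.2) (z, ζ) =
        Set.indicator (Set.pi Set.univ fun _ : κ => prodCapNhd ζ) (fun _ => g ζ) z := by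
      intro z
      have hz : (z, ζ) ∈ {q : (κ → E × F) × (E × F) | ∀ i, q.1 i ∈ prodCapNhd q.2} ↔
          z ∈ Set.pi Set.univ fun _ : κ => prodCapNhd ζ := Set.mem_univ_pi.symm
      by_cases h : z ∈ Set.pi Set.univ fun _ : κ => prodCapNhd ζ
      · rw [Set.indicator_of_mem h, Set.indicator_of_mem (hz.2 h)]
      · rw [Set.indicator_of_notMem h, Set.indicator_of_notMem (mt hz.1 h)]
    simp_rw [this]
    rw [lintegral_indicator_const, Measure.pi_pi, Finset.prod_const, Finset.card_univ]
    convert measurable_prodMk_right (y := ζ) hm using 1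
    ext z
    simp [Set.mem_pi]
  rw [h2]
  gcongr
  exact hC ζ hζ.1 hζ.2

variable (E F) in
lemma exists_measure_oneSided_le : ∃ c C : ℝ, 0 < c ∧ 0 < C ∧ ∀ (ι : Type) [Fintype ι]
    (I : Finset ι), I.card = finrank ℝ (E × F) → I.card < Fintype.card ι →
    (Measure.pi fun _ : ι => prodBallLaw E F) {x | OneSided x I} ≤
      2 * ∫⁻ ζ, (ENNReal.ofReal (c * capWeight ζ))⁻¹ * ENNReal.ofReal
        (Real.exp (-(((Fintype.card ι - finrank ℝ (E × F) : ℕ) : ℝ) * (c * capWeight ζ)))) *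
        ENNReal.ofReal (C * capWeight ζ) ^ finrank ℝ (E × F) ∂prodBallLaw E F := by
  classical
  obtain ⟨c, hc, hvis⟩ := exists_visible_subset E F
  obtain ⟨C, hC, hcap⟩ := exists_prodBallLaw_prodCapNhd_le E F
  refine ⟨c, C, hc, hC, fun ι _ I hI hIn => ?_⟩
  have hD := finrank_prod_pos (E := E) (F := F)
  set e := MeasurableEquiv.piEquivPiSubtypeProd (fun _ : ι => E × F) (· ∈ I) with he
  have hmp : MeasurePreserving e (Measure.pi fun _ : ι => prodBallLaw E F)
      ((Measure.pi fun _ : {i // i ∈ I} => prodBallLaw E F).prod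
        (Measure.pi fun _ : {i // i ∉ I} => prodBallLaw E F)) := by
    convert measurePreserving_piEquivPiSubtypeProd (fun _ : ι => prodBallLaw E F) (· ∈ I)
  have hm := measurableSet_oneSided (E := E × F) I
  have hcard : Fintype.card {i // i ∈ I} = finrank ℝ (E × F) := by simp [hI]
  have hcard' : Fintype.card {i // i ∉ I} = Fintype.card ι - finrank ℝ (E × F) := by
    rw [Fintype.card_subtype_compl, hcard]
  have : Nonempty {i // i ∈ I} := Fintype.card_pos_iff.1 (by omega)
  have : Nonempty {i // i ∉ I} := Fintype.card_pos_iff.1 (by omega)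
  rw [← (hmp.symm e).measure_preimage hm.nullMeasurableSet,
    Measure.prod_apply (e.symm.measurable hm)]
  have hfib : ∀ᵐ z ∂Measure.pi fun _ : {i // i ∈ I} => prodBallLaw E F,
      (Measure.pi fun _ : {i // i ∉ I} => prodBallLaw E F)
        (Prod.mk z ⁻¹' (e.symm ⁻¹' {x | OneSided x I})) ≤
      2 * ∫⁻ ζ in {ζ | ∀ i, z i ∈ prodCapNhd ζ}, (ENNReal.ofReal (c * capWeight ζ))⁻¹ *
        ENNReal.ofReal (Real.exp (-(Fintype.card {i // i ∉ I} * (c * capWeight ζ))))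
          ∂prodBallLaw E F := by
    have h1 := ae_affineIndependent (ι := {i // i ∈ I}) (ν := prodBallLaw E F)
      prodBallLaw_affineSubspace (by omega)
    have h2 : ∀ᵐ z ∂Measure.pi fun _ : {i // i ∈ I} => prodBallLaw E F,
        ∀ i, ‖(z i).1‖ < 1 ∧ ‖(z i).2‖ < 1 := by
      rw [ae_all_iff]
      exact fun i => (Measure.quasiMeasurePreserving_eval (fun _ => prodBallLaw E F) i).ae
        ae_prodBallLaw_norm_lt_one
    filter_upwards [h1, h2] with z hz hz1
    refine measure_oneSided_fiber_le hvis hz hcard hz1 ?_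
    rintro w ⟨l, s, hl, hls⟩
    refine ⟨l, s, fun i => ?_, fun j => ?_⟩
    · have := hl i i.2
      simpa [he, MeasurableEquiv.piEquivPiSubtypeProd, Equiv.piEquivPiSubtypeProd] using this
    · have := hls j j.2
      simpa [he, MeasurableEquiv.piEquivPiSubtypeProd, Equiv.piEquivPiSubtypeProd, j.2] using this
  refine (lintegral_mono_ae hfib).trans ?_
  rw [lintegral_const_mul' _ _ (by simp)]
  gcongr 2 * ?_
  have := lintegral_prodCapNhd_le (κ := {i // i ∈ I})
    (measurable_capIntegrand (E := E) (F := F) c (Fintype.card {i // i ∉ I})) hcap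
  rw [hcard, hcard'] at this
  rwa [hcard']

lemma cap_integrand_le {c C : ℝ} (hc : 0 < c) (hC : 0 < C) {D n j : ℕ} (hD : 0 < D) (hn : 0 < n)
    (hj : n ≤ 2 * j) {w : ℝ} (hw : 0 < w) :
    (ENNReal.ofReal (c * w))⁻¹ * ENNReal.ofReal (Real.exp (-(j * (c * w)))) *
      ENNReal.ofReal (C * w) ^ D ≤
    ENNReal.ofReal (C ^ D / c * (4 / c) ^ (D - 1) * (D - 1).factorial * ((n : ℝ) ^ (D - 1))⁻¹) *
      ENNReal.ofReal (Real.exp (-(c / 4 * n * w))) := by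
  have hn' : (0 : ℝ) < n := by exact_mod_cast hn
  rw [← ENNReal.ofReal_inv_of_pos (by positivity), ← ENNReal.ofReal_mul (by positivity),
    ← ENNReal.ofReal_pow (by positivity), ← ENNReal.ofReal_mul (by positivity),
    ← ENNReal.ofReal_mul (by positivity)]
  refine ENNReal.ofReal_le_ofReal ?_
  obtain ⟨m, rfl⟩ : ∃ m, D = m + 1 := ⟨D - 1, by omega⟩
  simp only [Nat.add_sub_cancel]
  set u := c / 4 * n * w with hu
  have hu0 : 0 < u := by positivity
  have h1 : Real.exp (-(j * (c * w))) ≤ Real.exp (-u) * Real.exp (-u) := by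
    rw [← Real.exp_add]
    refine Real.exp_le_exp.2 ?_
    have : (n : ℝ) ≤ 2 * j := by exact_mod_cast hj
    have : 0 < c * w := by positivity
    rw [hu]
    nlinarith
  have h2 : u ^ m * Real.exp (-u) ≤ m.factorial := by
    have := Real.pow_div_factorial_le_exp u hu0.le m
    rw [div_le_iff₀ (by positivity)] at this
    rw [Real.exp_neg, ← div_eq_mul_inv, div_le_iff₀ (Real.exp_pos _)]
    linarith
  have h3 : (c * w)⁻¹ * (C * w) ^ (m + 1) =
      C ^ (m + 1) / c * (4 / c) ^ m * ((n : ℝ) ^ m)⁻¹ * u ^ m := by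
    have h4 : (4 / c) ^ m * u ^ m = (n * w) ^ m := by
      rw [← mul_pow, hu]
      congr 1
      field_simp
    calc (c * w)⁻¹ * (C * w) ^ (m + 1)
        = C ^ (m + 1) / c * (((n : ℝ) ^ m)⁻¹ * (n * w) ^ m) := by
          rw [mul_pow, mul_pow, pow_succ w]
          field_simp
      _ = _ := by rw [← h4]; ring
  calc (c * w)⁻¹ * Real.exp (-(j * (c * w))) * (C * w) ^ (m + 1)
      = ((c * w)⁻¹ * (C * w) ^ (m + 1)) * Real.exp (-(j * (c * w))) := by ring
    _ ≤ ((c * w)⁻¹ * (C * w) ^ (m + 1)) * (Real.exp (-u) * Real.exp (-u)) := by gcongr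
    _ = C ^ (m + 1) / c * (4 / c) ^ m * ((n : ℝ) ^ m)⁻¹ * (u ^ m * Real.exp (-u)) *
        Real.exp (-u) := by rw [h3]; ring
    _ ≤ C ^ (m + 1) / c * (4 / c) ^ m * ((n : ℝ) ^ m)⁻¹ * m.factorial * Real.exp (-u) := by gcongr
    _ = _ := by ring

variable (E F) in
lemma exists_integral_faceCount_le : ∃ c K : ℝ, 0 < c ∧ 0 < K ∧
    ∀ n : ℕ, 2 * finrank ℝ (E × F) ≤ n →
    ∫ x : Fin n → E × F, (faceCount (convexHull ℝ (Set.range x)) (finrank ℝ (E × F) - 1) : ℝ)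
      ∂(Measure.pi fun _ => prodBallLaw E F) ≤
    K * n * (∫⁻ ζ, ENNReal.ofReal (Real.exp (-(c * n * capWeight ζ))) ∂prodBallLaw E F).toReal := by
  classical
  obtain ⟨c, C, hc, hC, h⟩ := exists_measure_oneSided_le E F
  set D := finrank ℝ (E × F) with hD
  have hD0 : 0 < D := finrank_prod_pos
  set K := C ^ D / c * (4 / c) ^ (D - 1) * (D - 1).factorial with hK
  have hK0 : 0 < K := by positivity
  refine ⟨c / 4, 2 * K, by positivity, by positivity, fun n hn => ?_⟩
  have hn' : (0 : ℝ) < n := by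
    have : 0 < n := by omega
    exact_mod_cast this
  rw [integral_faceCount prodBallLaw_affineSubspace (by rw [Fintype.card_fin]; omega) hD0]
  set J := ∫⁻ ζ, ENNReal.ofReal (Real.exp (-(c / 4 * n * capWeight ζ))) ∂prodBallLaw E F with hJ
  have hJtop : J ≠ ∞ := by
    refine (lt_of_le_of_lt (b := 1) ?_ ENNReal.one_lt_top).ne
    calc J ≤ ∫⁻ ζ, 1 ∂prodBallLaw E F := by
          refine lintegral_mono_ae ?_
          filter_upwards [ae_prodBallLaw_norm_lt_one] with ζ hζ
          have := capWeight_pos hζ.1 hζ.2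
          rw [← ENNReal.ofReal_one]
          refine ENNReal.ofReal_le_ofReal (Real.exp_le_one_iff.2 ?_)
          have : 0 < c / 4 * n * capWeight ζ := by positivity
          linarith
      _ = 1 := by simp
  have hI : ∀ I ∈ (Finset.univ : Finset (Fin n)).powersetCard D,
      (Measure.pi fun _ : Fin n => prodBallLaw E F).real {x | OneSided x I} ≤
      2 * K * ((n : ℝ) ^ (D - 1))⁻¹ * J.toReal := by
    intro I hI
    have hI := (Finset.mem_powersetCard.1 hI).2
    have h1 : (Measure.pi fun _ : Fin n => prodBallLaw E F) {x | OneSided x I} ≤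
        2 * (ENNReal.ofReal (K * ((n : ℝ) ^ (D - 1))⁻¹) * J) := by
      refine (h (Fin n) I hI (by rw [Fintype.card_fin]; omega)).trans ?_
      rw [hJ, ← lintegral_const_mul' _ _ ENNReal.ofReal_ne_top]
      gcongr 2 * ?_
      refine lintegral_mono_ae ?_
      filter_upwards [ae_prodBallLaw_norm_lt_one] with ζ hζ
      exact cap_integrand_le hc hC hD0 (by omega) (by rw [Fintype.card_fin]; omega)
        (capWeight_pos hζ.1 hζ.2)
    have h2 := ENNReal.toReal_mono (by finiteness) h1
    rw [ENNReal.toReal_mul, ENNReal.toReal_mul, ENNReal.toReal_ofReal (by positivity)] at h2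
    refine h2.trans_eq ?_
    simp only [ENNReal.toReal_ofNat]
    ring
  refine (Finset.sum_le_card_nsmul _ _ _ hI).trans ?_
  rw [Finset.card_powersetCard, Finset.card_univ, Fintype.card_fin, nsmul_eq_mul]
  have h3 : ((n.choose D : ℕ) : ℝ) ≤ (n : ℝ) ^ (D - 1) * n := by
    rw [← pow_succ, Nat.sub_add_cancel hD0]
    exact_mod_cast Nat.choose_le_pow n D
  have hJ0 : 0 ≤ J.toReal := ENNReal.toReal_nonneg
  calc ((n.choose D : ℕ) : ℝ) * (2 * K * ((n : ℝ) ^ (D - 1))⁻¹ * J.toReal)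
      ≤ ((n : ℝ) ^ (D - 1) * n) * (2 * K * ((n : ℝ) ^ (D - 1))⁻¹ * J.toReal) := by gcongr
    _ = 2 * K * n * J.toReal := by field_simp

end UpperBoundSum

section CapIntegral

open scoped ENNReal
open Module (finrank)

lemma lintegral_exp_neg_mul_rpow_le {p a : ℝ} (hp : 0 < p) (ha : 0 < a) :
    ∫⁻ s in Set.Ioo (0 : ℝ) 1, ENNReal.ofReal (Real.exp (-(a * s ^ p))) ≤
      ENNReal.ofReal (Real.Gamma (1 / p + 1) * a ^ (-1 / p)) := by
  have h := integral_exp_neg_mul_rpow hp ha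
  have hG : 0 < Real.Gamma (1 / p + 1) := Real.Gamma_pos_of_pos (by positivity)
  have hint : IntegrableOn (fun x : ℝ => Real.exp (-a * x ^ p)) (Set.Ioi 0) := by
    refine not_imp_comm.1 integral_undef ?_
    rw [h]
    positivity
  rw [mul_comm, ← h, ofReal_integral_eq_lintegral_ofReal hint
    (ae_of_all _ fun x => (Real.exp_pos _).le)]
  simp_rw [neg_mul]
  exact lintegral_mono_set Set.Ioo_subset_Ioi_self

lemma lintegral_exp_neg_mul_le_one {f : ℝ → ℝ} (hf : ∀ s ∈ Set.Ioo (0 : ℝ) 1, 0 ≤ f s) :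
    ∫⁻ s in Set.Ioo (0 : ℝ) 1, ENNReal.ofReal (Real.exp (-f s)) ≤ 1 := by
  calc ∫⁻ s in Set.Ioo (0 : ℝ) 1, ENNReal.ofReal (Real.exp (-f s))
      ≤ ∫⁻ _ in Set.Ioo (0 : ℝ) 1, 1 := by
        refine setLIntegral_mono measurable_const fun s hs => ?_
        rw [← ENNReal.ofReal_one]
        exact ENNReal.ofReal_le_ofReal (Real.exp_le_one_iff.2 (neg_nonpos.2 (hf s hs)))
    _ = 1 := by simp

/-- The integral of `exp (-N s ^ p t ^ q)` over the unit square. -/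
def squareIntegral (p q N : ℝ) : ℝ≥0∞ :=
  ∫⁻ t in Set.Ioo (0 : ℝ) 1, ∫⁻ s in Set.Ioo (0 : ℝ) 1,
    ENNReal.ofReal (Real.exp (-(N * t ^ q * s ^ p)))

lemma squareIntegral_le_of_lt {p q : ℝ} (hq : 0 < q) (hqp : q < p) {N : ℝ} (hN : 0 < N) :
    squareIntegral p q N ≤
      ENNReal.ofReal (Real.Gamma (1 / p + 1) * (1 - q / p)⁻¹ * N ^ (-1 / p)) := by
  have hp : 0 < p := hq.trans hqp
  have hG : 0 < Real.Gamma (1 / p + 1) := Real.Gamma_pos_of_pos (by positivity)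
  have hr : -1 < -(q / p) := by
    have := (div_lt_one hp).2 hqp
    linarith
  have hint : IntegrableOn (fun t : ℝ => t ^ (-(q / p))) (Set.Ioo 0 1) := by
    have := (intervalIntegral.intervalIntegrable_rpow' hr (a := 0) (b := 1)).1
    exact this.mono_set Set.Ioo_subset_Ioc_self
  have hval : ∫ t in Set.Ioo (0 : ℝ) 1, t ^ (-(q / p)) = (1 - q / p)⁻¹ := by
    rw [← integral_Ioc_eq_integral_Ioo, ← intervalIntegral.integral_of_le zero_le_one,
      integral_rpow (Or.inl hr), Real.one_rpow, Real.zero_rpow (by linarith)]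
    rw [sub_zero, one_div, neg_add_eq_sub]
  calc squareIntegral p q N
      ≤ ∫⁻ t in Set.Ioo (0 : ℝ) 1,
          ENNReal.ofReal (Real.Gamma (1 / p + 1) * N ^ (-1 / p)) * ENNReal.ofReal (t ^ (-(q / p))) := by
        refine setLIntegral_mono' measurableSet_Ioo fun t ht => ?_
        have ht0 := ht.1
        refine (lintegral_exp_neg_mul_rpow_le hp (by positivity)).trans_eq ?_
        rw [← ENNReal.ofReal_mul (by positivity), Real.mul_rpow hN.le (by positivity),
          ← Real.rpow_mul ht0.le]
        rw [← mul_assoc]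
        congr 3
        ring
    _ = ENNReal.ofReal (Real.Gamma (1 / p + 1) * N ^ (-1 / p)) *
          ENNReal.ofReal ((1 - q / p)⁻¹) := by
        rw [lintegral_const_mul' _ _ ENNReal.ofReal_ne_top, ← hval,
          ofReal_integral_eq_lintegral_ofReal hint]
        filter_upwards [ae_restrict_mem measurableSet_Ioo] with t ht
        exact Real.rpow_nonneg ht.1.le _
    _ = _ := by
        rw [← ENNReal.ofReal_mul (by positivity)]
        congr 1
        ring

lemma squareIntegral_self_le {p : ℝ} (hp : 0 < p) {N : ℝ} (hN : 1 < N) :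
    squareIntegral p p N ≤
      ENNReal.ofReal (N ^ (-1 / p) * (1 + Real.Gamma (1 / p + 1) / p * Real.log N)) := by
  have hN0 : 0 < N := by linarith
  have hG : 0 < Real.Gamma (1 / p + 1) := Real.Gamma_pos_of_pos (by positivity)
  set δ := N ^ (-1 / p) with hδ
  have hδ0 : 0 < δ := by positivity
  have hδ1 : δ < 1 := Real.rpow_lt_one_of_one_lt_of_neg hN (div_neg_of_neg_of_pos (by norm_num) hp)
  have hlog : Real.log N / p = Real.log (1 / δ) := by
    rw [one_div, Real.log_inv, hδ, Real.log_rpow hN0]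
    ring
  have h1 : ∫⁻ t in Set.Ioc (0 : ℝ) δ, ∫⁻ s in Set.Ioo (0 : ℝ) 1,
      ENNReal.ofReal (Real.exp (-(N * t ^ p * s ^ p))) ≤ ENNReal.ofReal δ := by
    calc _ ≤ ∫⁻ t in Set.Ioc (0 : ℝ) δ, 1 := by
          refine setLIntegral_mono measurable_const fun t ht => ?_
          refine lintegral_exp_neg_mul_le_one fun s hs => ?_
          have := ht.1
          have := hs.1
          positivity
      _ = ENNReal.ofReal δ := by simp
  have hint : IntegrableOn (fun t : ℝ => t⁻¹) (Set.Ioc δ 1) := by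
    have := (intervalIntegral.intervalIntegrable_inv (f := fun x : ℝ => x) (a := δ) (b := 1)
      (μ := volume) (fun x hx => ?_) continuousOn_id).1
    · exact this
    · rw [Set.uIcc_of_le hδ1.le] at hx
      linarith [hx.1]
  have h2 : ∫⁻ t in Set.Ioc δ 1, ∫⁻ s in Set.Ioo (0 : ℝ) 1,
      ENNReal.ofReal (Real.exp (-(N * t ^ p * s ^ p))) ≤
      ENNReal.ofReal (Real.Gamma (1 / p + 1) * δ * (Real.log N / p)) := by
    calc _ ≤ ∫⁻ t in Set.Ioc δ 1, ENNReal.ofReal (Real.Gamma (1 / p + 1) * δ) *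
            ENNReal.ofReal t⁻¹ := by
          refine setLIntegral_mono' measurableSet_Ioc fun t ht => ?_
          have ht0 : 0 < t := hδ0.trans ht.1
          refine (lintegral_exp_neg_mul_rpow_le hp (by positivity)).trans_eq ?_
          rw [← ENNReal.ofReal_mul (by positivity), Real.mul_rpow hN0.le (by positivity),
            ← Real.rpow_mul ht0.le, ← hδ, mul_div_cancel₀ _ hp.ne', Real.rpow_neg_one]
          congr 1
          ring
      _ = _ := by
          rw [lintegral_const_mul' _ _ ENNReal.ofReal_ne_top, hlog,
            ← integral_inv_of_pos hδ0 one_pos, intervalIntegral.integral_of_le hδ1.le,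
            ENNReal.ofReal_mul (p := Real.Gamma (1 / p + 1) * δ) (by positivity),
            ofReal_integral_eq_lintegral_ofReal hint]
          filter_upwards [ae_restrict_mem measurableSet_Ioc] with t ht
          have ht0 : 0 < t := hδ0.trans ht.1
          exact (inv_pos.2 ht0).le
  have hL : 0 < Real.log N := Real.log_pos hN
  calc squareIntegral p p N
      ≤ ∫⁻ t in Set.Ioc (0 : ℝ) δ ∪ Set.Ioc δ 1, ∫⁻ s in Set.Ioo (0 : ℝ) 1,
        ENNReal.ofReal (Real.exp (-(N * t ^ p * s ^ p))) := by
        refine lintegral_mono_set ?_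
        rw [Set.Ioc_union_Ioc_eq_Ioc hδ0.le hδ1.le]
        exact Set.Ioo_subset_Ioc_self
    _ ≤ _ := lintegral_union_le _ _ _
    _ ≤ _ := add_le_add h1 h2
    _ = _ := by
        rw [← ENNReal.ofReal_add (by positivity) (by positivity)]
        congr 1
        ring

variable {E : Type*} [NormedAddCommGroup E] [InnerProductSpace ℝ E] [FiniteDimensional ℝ E]
  [MeasureSpace E] [BorelSpace E] [(volume : Measure E).IsAddHaarMeasure] [Nontrivial E]
  {F : Type*} [NormedAddCommGroup F] [InnerProductSpace ℝ F] [FiniteDimensional ℝ F]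
  [MeasureSpace F] [BorelSpace F] [(volume : Measure F).IsAddHaarMeasure] [Nontrivial F]

lemma lintegral_uniformDist_closedBall_le {f : ℝ → ℝ≥0∞} (hf : Measurable f) :
    ∫⁻ x : E, f (1 - ‖x‖) ∂uniformDist (Metric.closedBall (0 : E) 1) ≤
      finrank ℝ E * ∫⁻ s in Set.Ioo (0 : ℝ) 1, f s := by
  rw [lintegral_uniformDist_closedBall hf]
  gcongr (finrank ℝ E : ℝ≥0∞) * ?_
  refine setLIntegral_mono' measurableSet_Ioo fun s hs => ?_
  refine (mul_le_mul_left ?_ _).trans_eq (one_mul _)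
  rw [← ENNReal.ofReal_one]
  exact ENNReal.ofReal_le_ofReal (pow_le_one₀ (by linarith [hs.2]) (by linarith [hs.1]))

lemma lintegral_prod_uniformDist_le {f : ℝ → ℝ → ℝ≥0∞} (hf : Measurable (Function.uncurry f)) :
    ∫⁻ x : E, ∫⁻ y : F, f (1 - ‖x‖) (1 - ‖y‖) ∂uniformDist (Metric.closedBall (0 : F) 1)
        ∂uniformDist (Metric.closedBall (0 : E) 1) ≤
      finrank ℝ E * finrank ℝ F * ∫⁻ s in Set.Ioo (0 : ℝ) 1, ∫⁻ t in Set.Ioo (0 : ℝ) 1, f s t := by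
  have hm : Measurable fun s : ℝ => ∫⁻ t in Set.Ioo (0 : ℝ) 1, f s t :=
    hf.lintegral_prod_right'
  calc _ ≤ ∫⁻ x : E, (finrank ℝ F * ∫⁻ t in Set.Ioo (0 : ℝ) 1, f (1 - ‖x‖) t)
          ∂uniformDist (Metric.closedBall (0 : E) 1) :=
        lintegral_mono fun x => lintegral_uniformDist_closedBall_le
          (hf.comp (measurable_const.prodMk measurable_id))
    _ = finrank ℝ F * ∫⁻ x : E, (∫⁻ t in Set.Ioo (0 : ℝ) 1, f (1 - ‖x‖) t)
          ∂uniformDist (Metric.closedBall (0 : E) 1) :=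
        lintegral_const_mul' _ _ (ENNReal.natCast_ne_top _)
    _ ≤ finrank ℝ F * (finrank ℝ E * ∫⁻ s in Set.Ioo (0 : ℝ) 1, ∫⁻ t in Set.Ioo (0 : ℝ) 1, f s t) := by
        gcongr
        exact lintegral_uniformDist_closedBall_le hm
    _ = _ := by ring

lemma lintegral_exp_capWeight_le (N : ℝ) :
    ∫⁻ ζ, ENNReal.ofReal (Real.exp (-(N * capWeight ζ))) ∂prodBallLaw E F ≤
      finrank ℝ F * finrank ℝ E * squareIntegral (capExp E) (capExp F) N := by
  have hm := measurable_capWeight (E := E) (F := F)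
  rw [lintegral_prod_symm _ (by fun_prop)]
  refine (lintegral_prod_uniformDist_le (E := F) (F := E) (f := fun t s =>
    ENNReal.ofReal (Real.exp (-(N * t ^ capExp F * s ^ capExp E)))) ?_).trans_eq' ?_
  · unfold Function.uncurry
    fun_prop
  · simp only [capWeight]
    congr! 7
    ring

lemma lintegral_exp_capWeight_le' (N : ℝ) :
    ∫⁻ ζ, ENNReal.ofReal (Real.exp (-(N * capWeight ζ))) ∂prodBallLaw E F ≤
      finrank ℝ F * finrank ℝ E * squareIntegral (capExp F) (capExp E) N := by
  have hm := measurable_capWeight (E := E) (F := F)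
  rw [lintegral_prod _ (by fun_prop), mul_comm (finrank ℝ F : ℝ≥0∞)]
  refine (lintegral_prod_uniformDist_le (E := E) (F := F) (f := fun t s =>
    ENNReal.ofReal (Real.exp (-(N * t ^ capExp E * s ^ capExp F)))) ?_).trans_eq' ?_
  · unfold Function.uncurry
    fun_prop
  · simp only [capWeight]
    congr! 7
    ring

end CapIntegral

section LowerBoundSum

open scoped ENNReal
open Module (finrank)

lemma measure_pi_pair {ι α : Type*} [Fintype ι] [MeasurableSpace α] {ν : Measure α}
    [IsProbabilityMeasure ν] {i j : ι} (hij : i ≠ j) {S : Set (α × α)} (hS : MeasurableSet S) :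
    (Measure.pi fun _ : ι => ν) {x | (x i, x j) ∈ S} = ∫⁻ z, ν (Prod.mk z ⁻¹' S) ∂ν := by
  have h := ProbabilityTheory.iIndepFun_pi (μ := fun _ : ι => ν) (X := fun _ => (id : α → α))
    fun _ => aemeasurable_id
  have h2 := (ProbabilityTheory.indepFun_iff_map_prod_eq_prod_map_map
    (measurable_pi_apply i).aemeasurable (measurable_pi_apply j).aemeasurable).1 (h.indepFun hij)
  have hmap : ∀ i : ι, (Measure.pi fun _ : ι => ν).map (fun x => x i) = ν := fun i =>
    (measurePreserving_eval (fun _ : ι => ν) i).map_eq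
  simp only [hmap] at h2
  rw [← Measure.prod_apply hS, ← h2, Measure.map_apply (by fun_prop) hS]
  rfl

variable {E : Type*} [NormedAddCommGroup E] [InnerProductSpace ℝ E] [FiniteDimensional ℝ E]
  [MeasureSpace E] [BorelSpace E] [(volume : Measure E).IsAddHaarMeasure] [Nontrivial E]
  {F : Type*} [NormedAddCommGroup F] [InnerProductSpace ℝ F] [FiniteDimensional ℝ F]
  [MeasureSpace F] [BorelSpace F] [(volume : Measure F).IsAddHaarMeasure] [Nontrivial F]

/-- The linear functional whose superlevel set at `z` is a small cap of the product of balls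
around `z`. -/
def capFunctional (z : E × F) : E × F →L[ℝ] ℝ :=
  ((1 - ‖z.1‖)⁻¹ * ‖z.1‖⁻¹) • (innerSL ℝ z.1).comp (ContinuousLinearMap.fst ℝ E F) +
    ((1 - ‖z.2‖)⁻¹ * ‖z.2‖⁻¹) • (innerSL ℝ z.2).comp (ContinuousLinearMap.snd ℝ E F)

lemma capFunctional_apply {E : Type*} [NormedAddCommGroup E] [InnerProductSpace ℝ E]
    {F : Type*} [NormedAddCommGroup F] [InnerProductSpace ℝ F] (z w : E × F) : capFunctional z w =
    (1 - ‖z.1‖)⁻¹ * ‖z.1‖⁻¹ * inner ℝ z.1 w.1 + (1 - ‖z.2‖)⁻¹ * ‖z.2‖⁻¹ * inner ℝ z.2 w.2 := by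
  simp [capFunctional]

/-- The points of norms in `(1/2, 1)` with small `capWeight`. -/
def nearBoundary (E F : Type*) [NormedAddCommGroup E] [InnerProductSpace ℝ E]
    [NormedAddCommGroup F] [InnerProductSpace ℝ F] (η : ℝ) : Set (E × F) :=
  {z | (1 / 2 < ‖z.1‖ ∧ ‖z.1‖ < 1) ∧ (1 / 2 < ‖z.2‖ ∧ ‖z.2‖ < 1) ∧ capWeight z ≤ η}

lemma measurableSet_nearBoundary {E : Type*} [NormedAddCommGroup E] [InnerProductSpace ℝ E]
    [MeasureSpace E] [BorelSpace E]
    {F : Type*} [NormedAddCommGroup F] [InnerProductSpace ℝ F] [MeasureSpace F]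
    [BorelSpace F] (η : ℝ) : MeasurableSet (nearBoundary E F η) := by
  have := measurable_capWeight (E := E) (F := F)
  unfold nearBoundary
  measurability

variable (E F) in
lemma exists_prodBallLaw_capFunctional_le : ∃ C > 0, ∀ z : E × F, (0 < ‖z.1‖ ∧ ‖z.1‖ < 1) →
    (0 < ‖z.2‖ ∧ ‖z.2‖ < 1) →
    prodBallLaw E F {w | capFunctional z z ≤ capFunctional z w} ≤
      ENNReal.ofReal (C * capWeight z) := by
  obtain ⟨C₁, hC₁, h₁⟩ := exists_uniformDist_ballCap_le E
  obtain ⟨C₂, hC₂, h₂⟩ := exists_uniformDist_ballCap_le F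
  refine ⟨C₁ * 2 ^ capExp E * (C₂ * 2 ^ capExp F), by positivity, fun z hx hy => ?_⟩
  have hs : 0 < 1 - ‖z.1‖ := by linarith
  have ht : 0 < 1 - ‖z.2‖ := by linarith
  have hx0 := hx.1
  have hy0 := hy.1
  have hu : ‖‖z.1‖⁻¹ • z.1‖ = 1 := by
    rw [norm_smul, norm_inv, norm_norm, inv_mul_cancel₀ hx0.ne']
  have hv : ‖‖z.2‖⁻¹ • z.2‖ = 1 := by
    rw [norm_smul, norm_inv, norm_norm, inv_mul_cancel₀ hy0.ne']
  have hsub : ∀ᵐ w ∂prodBallLaw E F, w ∈ {w | capFunctional z z ≤ capFunctional z w} →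
      w ∈ ballCap (‖z.1‖⁻¹ • z.1) (2 * (1 - ‖z.1‖)) ×ˢ
        ballCap (‖z.2‖⁻¹ • z.2) (2 * (1 - ‖z.2‖)) := by
    filter_upwards [ae_prodBallLaw_norm_lt_one] with w hw hzw
    have hi := real_inner_le_norm (‖z.1‖⁻¹ • z.1) w.1
    have hj := real_inner_le_norm (‖z.2‖⁻¹ • z.2) w.2
    rw [hu, one_mul] at hi
    rw [hv, one_mul] at hj
    change capFunctional z z ≤ capFunctional z w at hzw
    rw [capFunctional_apply, capFunctional_apply, real_inner_self_eq_norm_sq,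
      real_inner_self_eq_norm_sq, mul_assoc, mul_assoc, mul_assoc, mul_assoc,
      ← real_inner_smul_left z.1 w.1 ‖z.1‖⁻¹, ← real_inner_smul_left z.2 w.2 ‖z.2‖⁻¹] at hzw
    set a := inner ℝ (‖z.1‖⁻¹ • z.1) w.1
    set b := inner ℝ (‖z.2‖⁻¹ • z.2) w.2
    have e1 : ‖z.1‖⁻¹ * ‖z.1‖ ^ 2 = ‖z.1‖ := by field_simp
    have e2 : ‖z.2‖⁻¹ * ‖z.2‖ ^ 2 = ‖z.2‖ := by field_simp
    rw [e1, e2] at hzw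
    have f1 : (1 - ‖z.1‖)⁻¹ * (1 - a) = (1 - ‖z.1‖)⁻¹ * ‖z.1‖ + 1 - (1 - ‖z.1‖)⁻¹ * a := by
      field_simp
      ring
    have f2 : (1 - ‖z.2‖)⁻¹ * (1 - b) = (1 - ‖z.2‖)⁻¹ * ‖z.2‖ + 1 - (1 - ‖z.2‖)⁻¹ * b := by
      field_simp
      ring
    have g1 : 0 ≤ (1 - ‖z.1‖)⁻¹ * (1 - a) :=
      mul_nonneg (inv_pos.2 hs).le (by linarith [hw.1])
    have g2 : 0 ≤ (1 - ‖z.2‖)⁻¹ * (1 - b) :=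
      mul_nonneg (inv_pos.2 ht).le (by linarith [hw.2])
    refine ⟨⟨hw.1.le, ?_⟩, ⟨hw.2.le, ?_⟩⟩
    · have : (1 - ‖z.1‖)⁻¹ * (1 - a) ≤ 2 := by linarith
      rwa [inv_mul_le_iff₀ hs, mul_comm] at this
    · have : (1 - ‖z.2‖)⁻¹ * (1 - b) ≤ 2 := by linarith
      rwa [inv_mul_le_iff₀ ht, mul_comm] at this
  have hle : prodBallLaw E F {w | capFunctional z z ≤ capFunctional z w} ≤
      prodBallLaw E F (ballCap (‖z.1‖⁻¹ • z.1) (2 * (1 - ‖z.1‖)) ×ˢ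
        ballCap (‖z.2‖⁻¹ • z.2) (2 * (1 - ‖z.2‖))) := measure_mono_ae hsub
  refine hle.trans ?_
  rw [Measure.prod_prod]
  refine (mul_le_mul' (h₁ _ hu _ (by positivity)) (h₂ _ hv _ (by positivity))).trans_eq ?_
  rw [← ENNReal.ofReal_mul (by positivity), Real.mul_rpow zero_le_two hs.le,
    Real.mul_rpow zero_le_two ht.le, capWeight]
  congr 1
  ring

lemma measurableSet_capFunctional_le :
    MeasurableSet {q : (E × F) × (E × F) | capFunctional q.1 q.1 ≤ capFunctional q.1 q.2} := by
  simp_rw [capFunctional_apply]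
  refine measurableSet_le ?_ ?_ <;> fun_prop

variable (E F) in
lemma exists_le_integral_faceCount : ∃ a b : ℝ, 0 < a ∧ 0 < b ∧
    ∀ n : ℕ, finrank ℝ (E × F) + 1 ≤ n →
    b * n * (prodBallLaw E F).real (nearBoundary E F (a / n)) ≤
    ∫ x : Fin n → E × F, (faceCount (convexHull ℝ (Set.range x)) (finrank ℝ (E × F) - 1) : ℝ)
      ∂(Measure.pi fun _ => prodBallLaw E F) := by
  classical
  obtain ⟨C, hC, hcap⟩ := exists_prodBallLaw_capFunctional_le E F
  have hD : 0 < finrank ℝ (E × F) := finrank_prod_pos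
  have hD' : (0 : ℝ) < finrank ℝ (E × F) := by exact_mod_cast hD
  refine ⟨(2 * C)⁻¹, (2 * finrank ℝ (E × F) : ℝ)⁻¹, by positivity, by positivity, fun n hn => ?_⟩
  have hn0 : (0 : ℝ) < n := by
    have : 0 < n := by omega
    exact_mod_cast this
  set G := nearBoundary E F ((2 * C)⁻¹ / n) with hG
  have hGm : MeasurableSet G := measurableSet_nearBoundary _
  set A : Fin n → Set (Fin n → E × F) := fun i =>
    {x | x i ∈ G ∧ ∀ j ≠ i, capFunctional (x i) (x j) < capFunctional (x i) (x i)} with hA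
  have hB : ∀ i j : Fin n, MeasurableSet
      {x : Fin n → E × F | capFunctional (x i) (x i) ≤ capFunctional (x i) (x j)} := fun i j =>
    measurableSet_capFunctional_le.preimage
      (f := fun x : Fin n → E × F => (x i, x j)) (by fun_prop)
  have hAm : ∀ i, MeasurableSet (A i) := by
    intro i
    refine (hGm.preimage (measurable_pi_apply i)).inter ?_
    have : {x : Fin n → E × F | ∀ j ≠ i, capFunctional (x i) (x j) < capFunctional (x i) (x i)} =
        ⋂ j, ⋂ _ : j ≠ i,
          {x : Fin n → E × F | capFunctional (x i) (x i) ≤ capFunctional (x i) (x j)}ᶜ := by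
      ext x
      simp
    change MeasurableSet
      {x : Fin n → E × F | ∀ j ≠ i, capFunctional (x i) (x j) < capFunctional (x i) (x i)}
    rw [this]
    exact MeasurableSet.iInter fun j => MeasurableSet.iInter fun _ => (hB i j).compl
  have hge := integral_faceCount_ge prodBallLaw_affineSubspace (by rwa [Fintype.card_fin]) hD hAm
    (fun i => ae_of_all _ fun x hx => ⟨capFunctional (x i), hx.2⟩)
  have hlow : ∀ i, (prodBallLaw E F).real G / 2 ≤
      (Measure.pi fun _ : Fin n => prodBallLaw E F).real (A i) := by
    intro i
    set μ := Measure.pi fun _ : Fin n => prodBallLaw E F with hμ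
    have hpair : ∀ j ∈ Finset.univ.erase i, μ.real {x | x i ∈ G ∧
        capFunctional (x i) (x i) ≤ capFunctional (x i) (x j)} ≤
        (2 * n : ℝ)⁻¹ * (prodBallLaw E F).real G := by
      intro j hj
      have hij := (Finset.ne_of_mem_erase hj).symm
      have h1 := measure_pi_pair (ν := prodBallLaw E F) hij
        ((hGm.preimage measurable_fst).inter measurableSet_capFunctional_le)
      have h2 : μ {x | x i ∈ G ∧ capFunctional (x i) (x i) ≤ capFunctional (x i) (x j)} ≤
          ENNReal.ofReal (2 * n : ℝ)⁻¹ * prodBallLaw E F G := by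
        refine h1.trans_le ?_
        rw [← lintegral_indicator_const hGm]
        refine lintegral_mono fun z => ?_
        by_cases hz : z ∈ G
        · rw [Set.indicator_of_mem hz]
          obtain ⟨hz1, hz2, hz3⟩ := hz
          refine (measure_mono fun w hw => hw.2).trans
            ((hcap z ⟨by linarith, hz1.2⟩ ⟨by linarith, hz2.2⟩).trans (ENNReal.ofReal_le_ofReal ?_))
          calc C * capWeight z ≤ C * ((2 * C)⁻¹ / n) := by gcongr
            _ = _ := by field_simp
        · rw [Set.indicator_of_notMem hz, nonpos_iff_eq_zero, ← measure_empty (μ := prodBallLaw E F)]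
          congr 1
          exact Set.eq_empty_of_forall_notMem fun w hw => hz hw.1
      have h3 := ENNReal.toReal_mono (by finiteness) h2
      rwa [ENNReal.toReal_mul, ENNReal.toReal_ofReal (by positivity)] at h3
    have hcover : (fun x : Fin n → E × F => x i) ⁻¹' G ⊆ A i ∪ ⋃ j ∈ Finset.univ.erase i,
        {x | x i ∈ G ∧ capFunctional (x i) (x i) ≤ capFunctional (x i) (x j)} := by
      intro x hx
      by_cases h : x ∈ A i
      · exact Or.inl h
      · right
        have : ∃ j ≠ i, capFunctional (x i) (x i) ≤ capFunctional (x i) (x j) := by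
          by_contra! h'
          exact h ⟨hx, h'⟩
        obtain ⟨j, hji, hj⟩ := this
        exact Set.mem_biUnion (Finset.mem_erase.2 ⟨hji, Finset.mem_univ j⟩) ⟨hx, hj⟩
    have hGi : μ.real ((fun x : Fin n → E × F => x i) ⁻¹' G) = (prodBallLaw E F).real G := by
      rw [measureReal_def, measureReal_def,
        (measurePreserving_eval (fun _ : Fin n => prodBallLaw E F) i).measure_preimage
          hGm.nullMeasurableSet]
    have hsum := (measureReal_mono (μ := μ) hcover).trans ((measureReal_union_le _ _).trans
      (add_le_add_right (measureReal_biUnion_finset_le _ _) _))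
    have hs2 := Finset.sum_le_card_nsmul _ _ _ hpair
    rw [nsmul_eq_mul] at hs2
    have hcard : (((Finset.univ.erase i).card : ℕ) : ℝ) ≤ n := by
      exact_mod_cast (Finset.card_le_univ _).trans_eq (Fintype.card_fin n)
    have hG0 : 0 ≤ (prodBallLaw E F).real G := measureReal_nonneg
    have hs3 : (((Finset.univ.erase i).card : ℕ) : ℝ) *
        ((2 * n : ℝ)⁻¹ * (prodBallLaw E F).real G) ≤ (prodBallLaw E F).real G / 2 := by
      calc _ ≤ (n : ℝ) * ((2 * n : ℝ)⁻¹ * (prodBallLaw E F).real G) := by gcongr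
        _ = _ := by field_simp
    linarith
  have hsum := (Finset.card_nsmul_le_sum Finset.univ _ _ fun i _ => hlow i).trans hge
  rw [Finset.card_univ, Fintype.card_fin, nsmul_eq_mul] at hsum
  rw [mul_assoc, inv_mul_le_iff₀ (by positivity)]
  linarith

lemma le_lintegral_uniformDist_closedBall {f : ℝ → ℝ≥0∞} (hf : Measurable f)
    (h0 : ∀ s ∉ Set.Ioo (0 : ℝ) (1 / 2), f s = 0) :
    ENNReal.ofReal ((1 / 2) ^ (finrank ℝ E - 1)) * ∫⁻ s, f s ≤
      ∫⁻ x : E, f (1 - ‖x‖) ∂uniformDist (Metric.closedBall (0 : E) 1) := by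
  have hk : (1 : ℝ≥0∞) ≤ finrank ℝ E := by
    exact_mod_cast Module.finrank_pos (R := ℝ) (M := E)
  rw [lintegral_uniformDist_closedBall hf]
  refine le_mul_of_one_le_of_le hk ?_
  rw [← lintegral_const_mul' _ _ ENNReal.ofReal_ne_top, ← lintegral_indicator measurableSet_Ioo]
  refine lintegral_mono fun s => ?_
  by_cases hs : s ∈ Set.Ioo (0 : ℝ) (1 / 2)
  · have hs1 : s ∈ Set.Ioo (0 : ℝ) 1 := ⟨hs.1, by linarith [hs.2]⟩
    rw [Set.indicator_of_mem hs1]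
    gcongr
    linarith [hs.2]
  · simp [h0 s hs]

variable (E F) in
lemma exists_le_prodBallLaw_norm : ∃ c > 0, ∀ R : Set (ℝ × ℝ), MeasurableSet R →
    R ⊆ Set.Ioo 0 (1 / 2) ×ˢ Set.Ioo 0 (1 / 2) →
    ENNReal.ofReal c * volume R ≤ prodBallLaw E F {z | (1 - ‖z.1‖, 1 - ‖z.2‖) ∈ R} := by
  refine ⟨(1 / 2) ^ (finrank ℝ E - 1) * (1 / 2) ^ (finrank ℝ F - 1), by positivity,
    fun R hR hsub => ?_⟩
  have hm : Measurable (R.indicator (1 : ℝ × ℝ → ℝ≥0∞)) := measurable_one.indicator hR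
  have hms : MeasurableSet {z : E × F | (1 - ‖z.1‖, 1 - ‖z.2‖) ∈ R} :=
    hR.preimage (f := fun z : E × F => (1 - ‖z.1‖, 1 - ‖z.2‖)) (by fun_prop)
  have hg : Measurable fun s : ℝ => ∫⁻ t : ℝ, R.indicator (1 : ℝ × ℝ → ℝ≥0∞) (s, t) :=
    hm.lintegral_prod_right'
  have hind : ∀ s t : ℝ, (s ∉ Set.Ioo (0 : ℝ) (1 / 2) ∨ t ∉ Set.Ioo (0 : ℝ) (1 / 2)) →
      R.indicator (1 : ℝ × ℝ → ℝ≥0∞) (s, t) = 0 := by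
    intro s t hst
    refine Set.indicator_of_notMem (fun h => ?_) _
    obtain ⟨h1, h2⟩ := hsub h
    exact hst.elim (fun h => h h1) fun h => h h2
  have h1 : volume R = ∫⁻ s : ℝ, ∫⁻ t : ℝ, R.indicator (1 : ℝ × ℝ → ℝ≥0∞) (s, t) := by
    rw [← lintegral_indicator_one hR, Measure.volume_eq_prod, lintegral_prod _ hm.aemeasurable]
  have h2 : prodBallLaw E F {z | (1 - ‖z.1‖, 1 - ‖z.2‖) ∈ R} =
      ∫⁻ x : E, (∫⁻ y : F, R.indicator (1 : ℝ × ℝ → ℝ≥0∞) (1 - ‖x‖, 1 - ‖y‖)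
        ∂uniformDist (Metric.closedBall (0 : F) 1)) ∂uniformDist (Metric.closedBall (0 : E) 1) := by
    rw [← lintegral_indicator_one hms,
      lintegral_prod _ (measurable_one.indicator hms).aemeasurable]
    rfl
  rw [h1, h2, ENNReal.ofReal_mul (by positivity)]
  calc _ = ENNReal.ofReal ((1 / 2) ^ (finrank ℝ F - 1)) *
        (ENNReal.ofReal ((1 / 2) ^ (finrank ℝ E - 1)) *
          ∫⁻ s : ℝ, ∫⁻ t : ℝ, R.indicator (1 : ℝ × ℝ → ℝ≥0∞) (s, t)) := by ring
    _ ≤ ENNReal.ofReal ((1 / 2) ^ (finrank ℝ F - 1)) *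
        ∫⁻ x : E, (∫⁻ t : ℝ, R.indicator (1 : ℝ × ℝ → ℝ≥0∞) (1 - ‖x‖, t))
          ∂uniformDist (Metric.closedBall (0 : E) 1) := by
        gcongr ENNReal.ofReal ((1 / 2) ^ (finrank ℝ F - 1)) * ?_
        refine le_lintegral_uniformDist_closedBall hg fun s hs => ?_
        simp [hind s _ (Or.inl hs)]
    _ = ∫⁻ x : E, (ENNReal.ofReal ((1 / 2) ^ (finrank ℝ F - 1)) *
          ∫⁻ t : ℝ, R.indicator (1 : ℝ × ℝ → ℝ≥0∞) (1 - ‖x‖, t))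
            ∂uniformDist (Metric.closedBall (0 : E) 1) :=
        (lintegral_const_mul' _ _ ENNReal.ofReal_ne_top).symm
    _ ≤ _ := lintegral_mono fun x => le_lintegral_uniformDist_closedBall
        (f := fun t => R.indicator (1 : ℝ × ℝ → ℝ≥0∞) (1 - ‖x‖, t))
        (hm.comp (measurable_const.prodMk measurable_id)) fun t ht => hind _ t (Or.inr ht)

/-- The preimage of `nearBoundary` in the coordinates `1 - ‖x‖`, `1 - ‖y‖`. -/
def cornerRegion (p q η : ℝ) : Set (ℝ × ℝ) :=
  {r | (r.1 ∈ Set.Ioo 0 (1 / 2) ∧ r.2 ∈ Set.Ioo 0 (1 / 2)) ∧ r.1 ^ p * r.2 ^ q ≤ η}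

lemma measurableSet_cornerRegion (p q η : ℝ) : MeasurableSet (cornerRegion p q η) := by
  have h : MeasurableSet {r : ℝ × ℝ | r.1 ^ p * r.2 ^ q ≤ η} :=
    measurableSet_le (by fun_prop) measurable_const
  exact ((measurableSet_Ioo.preimage measurable_fst).inter
    (measurableSet_Ioo.preimage measurable_snd)).inter h

variable (E F) in
lemma exists_le_real_nearBoundary : ∃ c > 0, ∀ (η v : ℝ),
    ENNReal.ofReal v ≤ volume (cornerRegion (capExp E) (capExp F) η) →
    c * v ≤ (prodBallLaw E F).real (nearBoundary E F η) := by
  obtain ⟨c, hc, h⟩ := exists_le_prodBallLaw_norm E F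
  refine ⟨c, hc, fun η v hv => ?_⟩
  rcases le_or_gt v 0 with hv0 | hv0
  · exact (mul_nonpos_of_nonneg_of_nonpos hc.le hv0).trans measureReal_nonneg
  have h1 := h _ (measurableSet_cornerRegion (capExp E) (capExp F) η) fun r hr => hr.1
  have h2 : ENNReal.ofReal (c * v) ≤ prodBallLaw E F (nearBoundary E F η) := by
    rw [ENNReal.ofReal_mul hc.le]
    refine (mul_le_mul_right hv _).trans (h1.trans (measure_mono ?_))
    rintro z ⟨⟨hz1, hz2⟩, hz3⟩
    refine ⟨⟨?_, ?_⟩, ⟨?_, ?_⟩, hz3⟩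
    · linarith [hz1.2]
    · linarith [hz1.1]
    · linarith [hz2.2]
    · linarith [hz2.1]
  rw [measureReal_def]
  exact (ENNReal.ofReal_le_iff_le_toReal (measure_ne_top _ _)).1 h2

lemma le_volume_cornerRegion_left {p q η : ℝ} (hp : 0 < p) (hq : 0 < q) (hη : 0 < η)
    (hη' : η ^ p⁻¹ ≤ 1 / 2) :
    ENNReal.ofReal (η ^ p⁻¹ / 4) ≤ volume (cornerRegion p q η) := by
  have hδ : 0 < η ^ p⁻¹ := by positivity
  calc ENNReal.ofReal (η ^ p⁻¹ / 4)
      = volume (Set.Ioo 0 (η ^ p⁻¹) ×ˢ Set.Ioo (1 / 4 : ℝ) (1 / 2)) := by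
        rw [Measure.volume_eq_prod, Measure.prod_prod, Real.volume_Ioo, Real.volume_Ioo,
          ← ENNReal.ofReal_mul (by linarith)]
        congr 1
        ring
    _ ≤ _ := by
        refine measure_mono ?_
        rintro ⟨s, t⟩ ⟨⟨hs0, hs⟩, ⟨ht0, ht⟩⟩
        simp only at hs0 hs ht0 ht
        have ht1 : 0 < t := by linarith
        refine ⟨⟨⟨hs0, by simp only; linarith⟩, ⟨ht1, ht⟩⟩, ?_⟩
        calc s ^ p * t ^ q ≤ (η ^ p⁻¹) ^ p * 1 := by
              gcongr
              exact Real.rpow_le_one ht1.le (by linarith) hq.le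
          _ = η := by rw [mul_one, Real.rpow_inv_rpow hη.le hp.ne']

lemma le_volume_cornerRegion_right {p q η : ℝ} (hp : 0 < p) (hq : 0 < q) (hη : 0 < η)
    (hη' : η ^ q⁻¹ ≤ 1 / 2) :
    ENNReal.ofReal (η ^ q⁻¹ / 4) ≤ volume (cornerRegion p q η) := by
  have hδ : 0 < η ^ q⁻¹ := by positivity
  calc ENNReal.ofReal (η ^ q⁻¹ / 4)
      = volume (Set.Ioo (1 / 4 : ℝ) (1 / 2) ×ˢ Set.Ioo 0 (η ^ q⁻¹)) := by
        rw [Measure.volume_eq_prod, Measure.prod_prod, Real.volume_Ioo, Real.volume_Ioo,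
          ← ENNReal.ofReal_mul (by linarith)]
        congr 1
        ring
    _ ≤ _ := by
        refine measure_mono ?_
        rintro ⟨s, t⟩ ⟨⟨hs0, hs⟩, ⟨ht0, ht⟩⟩
        simp only at hs0 hs ht0 ht
        have hs1 : 0 < s := by linarith
        refine ⟨⟨⟨hs1, hs⟩, ⟨ht0, by simp only; linarith⟩⟩, ?_⟩
        calc s ^ p * t ^ q ≤ 1 * (η ^ q⁻¹) ^ q := by
              gcongr
              exact Real.rpow_le_one hs1.le (by linarith) hp.le
          _ = η := by rw [one_mul, Real.rpow_inv_rpow hη.le hq.ne']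

lemma le_volume_cornerRegion_self {p η : ℝ} (hp : 0 < p) (hη : 0 < η)
    (hη' : η ^ p⁻¹ ≤ 1 / 4) :
    ENNReal.ofReal (η ^ p⁻¹ * Real.log (1 / (4 * η ^ p⁻¹))) ≤ volume (cornerRegion p p η) := by
  set δ := η ^ p⁻¹ with hδ
  have hδ0 : 0 < δ := by positivity
  have hint : IntegrableOn (fun t : ℝ => t⁻¹) (Set.Ioc (2 * δ) (1 / 2)) := by
    refine (intervalIntegral.intervalIntegrable_inv (f := fun x : ℝ => x) (a := 2 * δ) (b := 1 / 2)
      (μ := volume) (fun x hx => ?_) continuousOn_id).1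
    rw [Set.uIcc_of_le (by linarith)] at hx
    linarith [hx.1]
  calc ENNReal.ofReal (δ * Real.log (1 / (4 * δ)))
      = ∫⁻ s in Set.Ioo (2 * δ) (1 / 2), ENNReal.ofReal (((fun s : ℝ => δ * s⁻¹) - fun _ : ℝ => (0 : ℝ)) s) := by
        have : Real.log (1 / (4 * δ)) = ∫ s in Set.Ioc (2 * δ) (1 / 2), s⁻¹ := by
          rw [← intervalIntegral.integral_of_le (by linarith),
            integral_inv_of_pos (by positivity) (by norm_num)]
          congr 1
          field_simp
          norm_num
        rw [this, restrict_Ioo_eq_restrict_Ioc, ← integral_const_mul,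
          ofReal_integral_eq_lintegral_ofReal (hint.const_mul δ)]
        · simp
        · filter_upwards [ae_restrict_mem measurableSet_Ioc] with s hs
          have : 0 < s := by linarith [hs.1]
          simp only [Pi.zero_apply]
          positivity
    _ = volume (regionBetween (fun _ => 0) (fun s => δ * s⁻¹) (Set.Ioo (2 * δ) (1 / 2))) := by
        rw [Measure.volume_eq_prod, volume_regionBetween_eq_lintegral (by fun_prop) (by fun_prop)
          measurableSet_Ioo]
    _ ≤ _ := by
        refine measure_mono ?_
        rintro ⟨s, t⟩ ⟨⟨hs0, hs⟩, ⟨ht0, ht⟩⟩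
        simp only at hs0 hs ht0 ht
        have hs1 : 0 < s := by linarith
        have hst : s * t ≤ δ := by
          rw [← div_eq_mul_inv, lt_div_iff₀ hs1] at ht
          linarith
        have ht2 : t < 1 / 2 := by
          by_contra! h
          nlinarith
        refine ⟨⟨⟨hs1, hs⟩, ⟨ht0, ht2⟩⟩, ?_⟩
        calc s ^ p * t ^ p = (s * t) ^ p := (Real.mul_rpow hs1.le ht0.le).symm
          _ ≤ δ ^ p := by gcongr
          _ = η := by rw [hδ, Real.rpow_inv_rpow hη.le hp.ne']

end LowerBoundSum

section Asymptotics

open scoped ENNReal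
open Module (finrank)

lemma exists_liminf_limsup_div {f g : ℕ → ℝ} (hg : ∀ᶠ n in atTop, 0 < g n)
    (hl : ∃ c > 0, ∀ᶠ n in atTop, c * g n ≤ f n) (hu : ∃ C, ∀ᶠ n in atTop, f n ≤ C * g n) :
    ∃ c C : ℝ, 0 < c ∧ c ≤ C ∧ c ≤ liminf (fun n => f n / g n) atTop ∧
      limsup (fun n => f n / g n) atTop ≤ C := by
  obtain ⟨c, hc, hl⟩ := hl
  obtain ⟨C, hu⟩ := hu
  have hl' : ∀ᶠ n in atTop, c ≤ f n / g n := by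
    filter_upwards [hg, hl] with n h1 h2
    rwa [le_div_iff₀ h1]
  have hu' : ∀ᶠ n in atTop, f n / g n ≤ C := by
    filter_upwards [hg, hu] with n h1 h2
    rwa [div_le_iff₀ h1]
  have hcC : c ≤ C := by
    obtain ⟨n, h1, h2⟩ := (hl'.and hu').exists
    exact h1.trans h2
  have hb : IsBoundedUnder (· ≤ ·) atTop fun n => f n / g n := ⟨C, hu'⟩
  have hb' : IsBoundedUnder (· ≥ ·) atTop fun n => f n / g n := ⟨c, hl'⟩
  exact ⟨c, C, hc, hcC, le_liminf_of_le hb.isCoboundedUnder_ge hl',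
    limsup_le_of_le hb'.isCoboundedUnder_le hu'⟩

lemma tendsto_const_div_nat_rpow (a : ℝ) {p : ℝ} (hp : 0 < p) :
    Tendsto (fun n : ℕ => (a / n) ^ p⁻¹) atTop (nhds 0) := by
  have h := (tendsto_const_div_atTop_nhds_zero_nat a).rpow_const (p := p⁻¹)
    (Or.inr (by positivity))
  rwa [Real.zero_rpow (by positivity)] at h

lemma nat_mul_rpow_eq {n : ℕ} (hn : 0 < n) (r : ℝ) : (n : ℝ) * (n : ℝ) ^ r = (n : ℝ) ^ (1 + r) := by
  rw [Real.rpow_add (by exact_mod_cast hn), Real.rpow_one]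

section

variable (E F : Type*) [NormedAddCommGroup E] [InnerProductSpace ℝ E]
  [MeasureSpace E] [NormedAddCommGroup F] [InnerProductSpace ℝ F] [MeasureSpace F]

/-- Expected number of facets of the convex hull of `n` independent random points with law
`prodBallLaw E F`. -/
def expectedFacets (n : ℕ) : ℝ :=
  ∫ x : Fin n → E × F, (faceCount (convexHull ℝ (Set.range x)) (finrank ℝ (E × F) - 1) : ℝ)
    ∂(Measure.pi fun _ => prodBallLaw E F)

end

variable {E : Type*} [NormedAddCommGroup E] [InnerProductSpace ℝ E] [FiniteDimensional ℝ E]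
  [MeasureSpace E] [BorelSpace E] [(volume : Measure E).IsAddHaarMeasure] [Nontrivial E]
  {F : Type*} [NormedAddCommGroup F] [InnerProductSpace ℝ F] [FiniteDimensional ℝ F]
  [MeasureSpace F] [BorelSpace F] [(volume : Measure F).IsAddHaarMeasure] [Nontrivial F]

lemma exists_expectedFacets_le_of_lt {p q : ℝ} (hq : 0 < q) (hqp : q < p)
    (hJ : ∀ N : ℝ, ∫⁻ ζ, ENNReal.ofReal (Real.exp (-(N * capWeight ζ))) ∂prodBallLaw E F ≤
      finrank ℝ F * finrank ℝ E * squareIntegral p q N) :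
    ∃ C, ∀ᶠ n : ℕ in atTop, expectedFacets E F n ≤ C * (n : ℝ) ^ (1 - 1 / p) := by
  obtain ⟨c, K, hc, hK, h⟩ := exists_integral_faceCount_le E F
  have hp : 0 < p := hq.trans hqp
  have hG : 0 < Real.Gamma (1 / p + 1) := Real.Gamma_pos_of_pos (by positivity)
  have hqp' : 0 < (1 - q / p)⁻¹ := by
    have := (div_lt_one hp).2 hqp
    exact inv_pos.2 (by linarith)
  set A := Real.Gamma (1 / p + 1) * (1 - q / p)⁻¹ with hA
  refine ⟨K * (finrank ℝ F * finrank ℝ E * (A * c ^ (-1 / p))), ?_⟩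
  filter_upwards [eventually_ge_atTop (2 * finrank ℝ (E × F)), eventually_gt_atTop 0] with n hn hn0
  have hn' : (0 : ℝ) < n := by exact_mod_cast hn0
  refine (h n hn).trans ?_
  have h1 := (hJ (c * n)).trans (mul_le_mul_right (squareIntegral_le_of_lt hq hqp (by positivity)) _)
  have h2 := ENNReal.toReal_mono (by finiteness) h1
  rw [ENNReal.toReal_mul, ENNReal.toReal_mul, ENNReal.toReal_ofReal (by positivity),
    ENNReal.toReal_natCast, ENNReal.toReal_natCast, Real.mul_rpow hc.le hn'.le] at h2
  calc _ ≤ K * n * (finrank ℝ F * finrank ℝ E * (A * (c ^ (-1 / p) * (n : ℝ) ^ (-1 / p)))) := by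
        gcongr
    _ = K * (finrank ℝ F * finrank ℝ E * (A * c ^ (-1 / p))) * (n * (n : ℝ) ^ (-1 / p)) := by ring
    _ = _ := by
        rw [nat_mul_rpow_eq hn0]
        congr 2
        ring

lemma exists_expectedFacets_le_of_eq (hEF : capExp E = capExp F) :
    ∃ C, ∀ᶠ n : ℕ in atTop,
      expectedFacets E F n ≤ C * ((n : ℝ) ^ (1 - 1 / capExp E) * Real.log n) := by
  obtain ⟨c, K, hc, hK, h⟩ := exists_integral_faceCount_le E F
  have hp : 0 < capExp E := capExp_pos
  have hJ := lintegral_exp_capWeight_le (E := E) (F := F)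
  rw [← hEF] at hJ
  set p := capExp E
  have hG : 0 < Real.Gamma (1 / p + 1) := Real.Gamma_pos_of_pos (by positivity)
  set A := Real.Gamma (1 / p + 1) / p with hA
  have hA0 : 0 < A := by positivity
  refine ⟨K * (finrank ℝ F * finrank ℝ E * (c ^ (-1 / p) * (1 + A * 2))), ?_⟩
  have hcn : Tendsto (fun n : ℕ => c * n) atTop atTop :=
    tendsto_natCast_atTop_atTop.const_mul_atTop hc
  have hlog : Tendsto (fun n : ℕ => Real.log n) atTop atTop :=
    Real.tendsto_log_atTop.comp tendsto_natCast_atTop_atTop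
  filter_upwards [eventually_ge_atTop (2 * finrank ℝ (E × F)), eventually_gt_atTop 0,
    hcn.eventually_gt_atTop 1, hlog.eventually_ge_atTop 1,
    hlog.eventually_ge_atTop (Real.log c)] with n hn hn0 hcn1 hlog1 hlogc
  have hn' : (0 : ℝ) < n := by exact_mod_cast hn0
  refine (h n hn).trans ?_
  have hL : 0 < Real.log (c * n) := Real.log_pos hcn1
  have h1 := (hJ (c * n)).trans (mul_le_mul_right (squareIntegral_self_le hp hcn1) _)
  have h2 := ENNReal.toReal_mono (by finiteness) h1
  rw [ENNReal.toReal_mul, ENNReal.toReal_mul, ENNReal.toReal_ofReal (by positivity),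
    ENNReal.toReal_natCast, ENNReal.toReal_natCast, Real.mul_rpow hc.le hn'.le,
    Real.log_mul hc.ne' hn'.ne'] at h2
  calc _ ≤ K * n * (finrank ℝ F * finrank ℝ E * (c ^ (-1 / p) * (n : ℝ) ^ (-1 / p) *
            (1 + A * (Real.log c + Real.log n)))) := by
        gcongr
    _ ≤ K * n * (finrank ℝ F * finrank ℝ E * (c ^ (-1 / p) * (n : ℝ) ^ (-1 / p) *
            (Real.log n + A * (Real.log n + Real.log n)))) := by
        gcongr
    _ = K * (finrank ℝ F * finrank ℝ E * (c ^ (-1 / p) * (1 + A * 2))) *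
          ((n * (n : ℝ) ^ (-1 / p)) * Real.log n) := by ring
    _ = _ := by
        rw [nat_mul_rpow_eq hn0]
        congr 4
        ring

lemma exists_le_expectedFacets {p : ℝ} (hp : 0 < p)
    (hR : ∀ η : ℝ, 0 < η → η ^ p⁻¹ ≤ 1 / 2 →
      ENNReal.ofReal (η ^ p⁻¹ / 4) ≤ volume (cornerRegion (capExp E) (capExp F) η)) :
    ∃ c > 0, ∀ᶠ n : ℕ in atTop, c * (n : ℝ) ^ (1 - 1 / p) ≤ expectedFacets E F n := by
  obtain ⟨a, b, ha, hb, h⟩ := exists_le_integral_faceCount E F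
  obtain ⟨c, hc, hv⟩ := exists_le_real_nearBoundary E F
  refine ⟨b * (c * (a ^ p⁻¹ / 4)), by positivity, ?_⟩
  filter_upwards [eventually_ge_atTop (finrank ℝ (E × F) + 1), eventually_gt_atTop 0,
    (tendsto_const_div_nat_rpow a hp).eventually_le_const (show (0 : ℝ) < 1 / 2 by norm_num)]
    with n hn hn0 hη
  have hn' : (0 : ℝ) < n := by exact_mod_cast hn0
  refine le_trans ?_ (h n hn)
  have h1 := hv _ _ (hR (a / n) (by positivity) hη)
  have h2 : (a / n) ^ p⁻¹ = a ^ p⁻¹ * (n : ℝ) ^ (-p⁻¹) := by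
    rw [Real.div_rpow ha.le hn'.le, Real.rpow_neg hn'.le, div_eq_mul_inv]
  calc b * (c * (a ^ p⁻¹ / 4)) * (n : ℝ) ^ (1 - 1 / p)
      = b * (c * (a ^ p⁻¹ / 4)) * (n * (n : ℝ) ^ (-p⁻¹)) := by
        rw [nat_mul_rpow_eq hn0, one_div, sub_eq_add_neg]
    _ = b * n * (c * ((a / n) ^ p⁻¹ / 4)) := by rw [h2]; ring
    _ ≤ _ := by gcongr

lemma exists_le_expectedFacets_of_eq (hEF : capExp E = capExp F) :
    ∃ c > 0, ∀ᶠ n : ℕ in atTop,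
      c * ((n : ℝ) ^ (1 - 1 / capExp E) * Real.log n) ≤ expectedFacets E F n := by
  obtain ⟨a, b, ha, hb, h⟩ := exists_le_integral_faceCount E F
  obtain ⟨c, hc, hv⟩ := exists_le_real_nearBoundary E F
  have hp : 0 < capExp E := capExp_pos
  rw [← hEF] at hv
  set p := capExp E
  refine ⟨b * (c * (a ^ p⁻¹ * (2 * p)⁻¹)), by positivity, ?_⟩
  have hlog : Tendsto (fun n : ℕ => Real.log n) atTop atTop :=
    Real.tendsto_log_atTop.comp tendsto_natCast_atTop_atTop
  filter_upwards [eventually_ge_atTop (finrank ℝ (E × F) + 1), eventually_gt_atTop 0,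
    (tendsto_const_div_nat_rpow a hp).eventually_le_const (show (0 : ℝ) < 1 / 4 by norm_num),
    hlog.eventually_ge_atTop (2 * p * (p⁻¹ * Real.log a + Real.log 4))]
    with n hn hn0 hη hlogn
  have hn' : (0 : ℝ) < n := by exact_mod_cast hn0
  refine le_trans ?_ (h n hn)
  have h1 := hv _ _ (le_volume_cornerRegion_self hp (η := a / n) (by positivity) hη)
  have h2 : (a / n) ^ p⁻¹ = a ^ p⁻¹ * (n : ℝ) ^ (-p⁻¹) := by
    rw [Real.div_rpow ha.le hn'.le, Real.rpow_neg hn'.le, div_eq_mul_inv]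
  have h3 : (2 * p)⁻¹ * Real.log n ≤ Real.log (1 / (4 * (a / n) ^ p⁻¹)) := by
    have h4 : p⁻¹ * Real.log a + Real.log 4 ≤ (2 * p)⁻¹ * Real.log n := by
      rw [le_inv_mul_iff₀ (by positivity)]
      exact hlogn
    rw [one_div, Real.log_inv, Real.log_mul (by norm_num) (by positivity),
      Real.log_rpow (by positivity), Real.log_div ha.ne' hn'.ne']
    have h5 : (2 * p)⁻¹ * Real.log n + (2 * p)⁻¹ * Real.log n = p⁻¹ * Real.log n := by
      field_simp
      ring
    linarith
  calc b * (c * (a ^ p⁻¹ * (2 * p)⁻¹)) * ((n : ℝ) ^ (1 - 1 / p) * Real.log n)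
      = b * (c * (a ^ p⁻¹ * (2 * p)⁻¹)) * ((n * (n : ℝ) ^ (-p⁻¹)) * Real.log n) := by
        rw [nat_mul_rpow_eq hn0, one_div, sub_eq_add_neg]
    _ = b * n * (c * ((a / n) ^ p⁻¹ * ((2 * p)⁻¹ * Real.log n))) := by rw [h2]; ring
    _ ≤ b * n * (c * ((a / n) ^ p⁻¹ * Real.log (1 / (4 * (a / n) ^ p⁻¹)))) := by gcongr
    _ ≤ _ := by gcongr

lemma one_sub_one_div_capExp {E : Type*} [AddCommGroup E] [Module ℝ E] {k : ℕ} (hk : finrank ℝ E = k) :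
    1 - 1 / capExp E = ((k : ℝ) - 1) / (k + 1) := by
  rw [capExp, hk]
  have : (k : ℝ) + 1 ≠ 0 := by positivity
  field_simp
  ring

end Asymptotics

lemma expectedFacetsProd_eq {d k : ℕ} (hk1 : 1 ≤ k) (hk2 : k ≤ d - 1) (n : ℕ) :
    expectedFacetsProd d k n =
      expectedFacets (EuclideanSpace ℝ (Fin k)) (EuclideanSpace ℝ (Fin (d - k))) n := by
  have : NeZero k := ⟨by omega⟩
  have : NeZero (d - k) := ⟨by omega⟩
  rw [expectedFacetsProd, expectedFacets, uniformDist_prod_eq, Module.finrank_prod,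
    finrank_euclideanSpace_fin, finrank_euclideanSpace_fin, Nat.add_sub_cancel' (by omega)]

/-- **The case `m = 2` of two factors**: for the uniform random polytope in
`B_2^k × B_2^{d−k}` one has `E f_{d−1}(P_n) ≍ n^{(k−1)/(k+1)} ln n` in the Lagrangian
case `2k = d`, and `E f_{d−1}(P_n) ≍ n^{(M−1)/(M+1)}` with `M = max{k, d−k}`
otherwise. -/
theorem expected_facets_two_blocks
    (d k : ℕ) (hd : 2 ≤ d) (hk1 : 1 ≤ k) (hk2 : k ≤ d - 1) :
    (2 * k = d →
      ∃ c C : ℝ, 0 < c ∧ c ≤ C ∧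
        c ≤ liminf (fun n : ℕ => expectedFacetsProd d k n /
              ((n : ℝ) ^ (((k : ℝ) - 1) / ((k : ℝ) + 1)) * Real.log n)) atTop ∧
        limsup (fun n : ℕ => expectedFacetsProd d k n /
              ((n : ℝ) ^ (((k : ℝ) - 1) / ((k : ℝ) + 1)) * Real.log n)) atTop ≤ C) ∧
    (2 * k ≠ d →
      ∃ c C : ℝ, 0 < c ∧ c ≤ C ∧
        c ≤ liminf (fun n : ℕ => expectedFacetsProd d k n /
              (n : ℝ) ^ (((max k (d - k) : ℝ) - 1) / ((max k (d - k) : ℝ) + 1))) atTop ∧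
        limsup (fun n : ℕ => expectedFacetsProd d k n /
              (n : ℝ) ^ (((max k (d - k) : ℝ) - 1) / ((max k (d - k) : ℝ) + 1))) atTop ≤ C) := by
  have : NeZero k := ⟨by omega⟩
  have : NeZero (d - k) := ⟨by omega⟩
  simp_rw [expectedFacetsProd_eq hk1 hk2]
  have hE := finrank_euclideanSpace_fin (𝕜 := ℝ) (n := k)
  have hF := finrank_euclideanSpace_fin (𝕜 := ℝ) (n := d - k)
  have hcast : ((d - k : ℕ) : ℝ) = (d : ℝ) - k := Nat.cast_sub (by omega)
  have hEp := capExp_pos (E := EuclideanSpace ℝ (Fin k))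
  have hFp := capExp_pos (E := EuclideanSpace ℝ (Fin (d - k)))
  have hexpE := one_sub_one_div_capExp hE
  have hexpF := one_sub_one_div_capExp hF
  refine ⟨fun h => ?_, fun h => ?_⟩
  · have hEF : capExp (EuclideanSpace ℝ (Fin k)) = capExp (EuclideanSpace ℝ (Fin (d - k))) := by
      rw [capExp, capExp, hE, hF, show d - k = k by omega]
    refine exists_liminf_limsup_div ?_ ?_ ?_
    · filter_upwards [eventually_gt_atTop 1] with n hn
      have hn' : (1 : ℝ) < n := by exact_mod_cast hn
      have := Real.log_pos hn'
      positivity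
    · rw [← hexpE]
      exact exists_le_expectedFacets_of_eq hEF
    · rw [← hexpE]
      exact exists_expectedFacets_le_of_eq hEF
  · have hpos : ∀ r : ℝ, ∀ᶠ n : ℕ in atTop, 0 < (n : ℝ) ^ r := by
      intro r
      filter_upwards [eventually_gt_atTop 0] with n hn
      have hn' : (0 : ℝ) < n := by exact_mod_cast hn
      positivity
    refine exists_liminf_limsup_div (hpos _) ?_ ?_ <;>
    rcases lt_or_gt_of_ne (show k ≠ d - k by omega) with hlt | hlt
    · have hlt' : (k : ℝ) < (d - k : ℕ) := by exact_mod_cast hlt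
      rw [← hcast, max_eq_right hlt'.le, ← hexpF]
      exact exists_le_expectedFacets hFp fun η => le_volume_cornerRegion_right hEp hFp
    · have hlt' : ((d - k : ℕ) : ℝ) < k := by exact_mod_cast hlt
      rw [← hcast, max_eq_left hlt'.le, ← hexpE]
      exact exists_le_expectedFacets hEp fun η => le_volume_cornerRegion_left hEp hFp
    · have hlt' : (k : ℝ) < (d - k : ℕ) := by exact_mod_cast hlt
      rw [← hcast, max_eq_right hlt'.le, ← hexpF]
      refine exists_expectedFacets_le_of_lt hEp ?_ lintegral_exp_capWeight_le'
      rw [capExp, capExp, hE, hF]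
      linarith
    · have hlt' : ((d - k : ℕ) : ℝ) < k := by exact_mod_cast hlt
      rw [← hcast, max_eq_left hlt'.le, ← hexpE]
      refine exists_expectedFacets_le_of_lt hFp ?_ lintegral_exp_capWeight_le
      rw [capExp, capExp, hE, hF]
      linarith
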